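/- arXiv:0711.1845 — 14 statements merged into one kernel-verified Lean document; each statement's English description precedes it below -/
import Mathlib

section
/- Let G be a group that does not contain a nontrivial free product, in the sense that for any two nontrivial subgroups A, B of G the canonical homomorphism from the free product A ∗ B to G induced by the inclusions is not injective. Let X be a set, and let G act on the set X^G of functions G → X by (g·α)(h) = α(g⁻¹h). Suppose α, β : G → X are such that there exists a unique g₀ ∈ G with α(g₀) ≠ β(g₀). If the stabilizer of α in G is nontrivial, then the stabilizer of β in G is trivial. -/
/-- The subgroup of elements leaving `α` invariant under left translation. -/
def leftTranslationStabilizer {G X : Type*} [Group G] (α : G → X) : Subgroup G where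
  carrier := {g | ∀ h, α (g * h) = α h}
  one_mem' := by simp
  mul_mem' := by
    intro a b ha hb h
    rw [mul_assoc, ha, hb]
  inv_mem' := by
    intro a ha h
    rw [← ha (a⁻¹ * h), mul_inv_cancel_left]

/-- Two subgroups all of whose nonempty reduced words are nontrivial generate their free
product. -/
theorem coprod_lift_subtype_injective {G : Type*} [Group G] (H : Bool → Subgroup G)
    (hH : ∀ l : List (Bool × G), l ≠ [] → (∀ p ∈ l, p.2 ∈ H p.1 ∧ p.2 ≠ 1) →
      l.IsChain (fun p q => p.1 ≠ q.1) → (l.map Prod.snd).prod ≠ 1) :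
    Function.Injective (Monoid.Coprod.lift (H true).subtype (H false).subtype) := by
  classical
  let φ : Monoid.Coprod (H true) (H false) →* Monoid.CoprodI (fun i => H i) :=
    Monoid.Coprod.lift (Monoid.CoprodI.of (M := fun i => H i) (i := true))
      (Monoid.CoprodI.of (M := fun i => H i) (i := false))
  let ψ : Monoid.CoprodI (fun i => H i) →* Monoid.Coprod (H true) (H false) :=
    Monoid.CoprodI.lift (fun i => match i with
      | true => Monoid.Coprod.inl
      | false => Monoid.Coprod.inr)
  let L : Monoid.CoprodI (fun i => H i) →* G := Monoid.CoprodI.lift (fun i => (H i).subtype)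
  have hψφ : ψ.comp φ = MonoidHom.id _ := by
    apply Monoid.Coprod.hom_ext <;> ext x <;> simp [φ, ψ]
  have hφ : Function.Injective φ :=
    Function.LeftInverse.injective (g := ψ) (DFunLike.congr_fun hψφ)
  have hLφ : Monoid.Coprod.lift (H true).subtype (H false).subtype = L.comp φ := by
    apply Monoid.Coprod.hom_ext <;> ext x <;> simp [φ, L]
  have hL : Function.Injective L := by
    rw [injective_iff_map_eq_one]
    intro x hx
    obtain ⟨w, rfl⟩ := (Monoid.CoprodI.Word.equiv (M := fun i => H i)).symm.surjective x
    change L w.prod = 1 at hx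
    change w.prod = 1
    by_cases hw : w.toList = []
    · simp [Monoid.CoprodI.Word.prod, hw]
    · refine absurd ?_ (hH (w.toList.map fun p => (p.1, (p.2 : G))) (by simpa using hw) ?_ ?_)
      · rw [Monoid.CoprodI.Word.prod, map_list_prod] at hx
        simpa [L, Function.comp_def] using hx
      · intro p hp
        obtain ⟨q, hq, rfl⟩ := List.mem_map.1 hp
        exact ⟨q.2.2, fun h => w.ne_one q hq (Subtype.ext h)⟩
      · rw [List.isChain_map]
        exact w.chain_ne
  rw [hLφ]
  exact hL.comp hφ

theorem apply_prod_eq_of_suffixes_ne_one {G X : Type*} [Group G] {f : Bool → G → X}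
    (hf : ∀ i h, h ≠ 1 → f i h = f (!i) h) (i : Bool) (b : G)
    (hb : b ∈ leftTranslationStabilizer (f i)) (s : List (Bool × G))
    (hs : ∀ p ∈ s, p.2 ∈ leftTranslationStabilizer (f p.1))
    (hne : ∀ t, t <:+ s → (t.map Prod.snd).prod * b ≠ 1) (k : Bool) :
    f k ((s.map Prod.snd).prod * b) = f i 1 := by
  have key : ∀ k j h, h ≠ 1 → f j h = f i 1 → f k h = f i 1 := by
    intro k j h hh hj
    obtain rfl | rfl := Bool.eq_or_eq_not k j
    · exact hj
    · rw [← hj, hf j h hh]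
  induction s generalizing k with
  | nil =>
    refine key k i _ (hne [] List.suffix_rfl) ?_
    simpa using hb 1
  | cons p s ih =>
    refine key k p.1 _ (hne _ List.suffix_rfl) ?_
    rw [List.map_cons, List.prod_cons, mul_assoc, hs p (by simp)]
    exact ih (fun q hq => hs q (by simp [hq]))
      (fun t ht => hne t (ht.trans (List.suffix_cons p s))) p.1

theorem reduced_word_prod_ne_one {G X : Type*} [Group G] {f : Bool → G → X}
    (hf : ∀ i h, h ≠ 1 → f i h = f (!i) h) (hf1 : ∀ i, f i 1 ≠ f (!i) 1) (l : List (Bool × G))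
    (hl : l ≠ []) (hmem : ∀ p ∈ l, p.2 ∈ leftTranslationStabilizer (f p.1) ∧ p.2 ≠ 1)
    (hchain : l.IsChain (fun p q => p.1 ≠ q.1)) : (l.map Prod.snd).prod ≠ 1 := by
  induction hn : l.length using Nat.strong_induction_on generalizing l with
  | _ n ih =>
  subst hn
  obtain ⟨s, ⟨i, b⟩, rfl⟩ := List.eq_nil_or_concat l |>.resolve_left hl
  cases s with
  | nil => simpa using (hmem (i, b) (by simp)).2
  | cons p u =>
    obtain ⟨j, a⟩ := p
    simp only [List.concat_eq_append, List.cons_append] at *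
    have ha := (hmem (j, a) (by simp)).1
    have hb := (hmem (i, b) (by simp)).1
    have htail := hchain.tail
    simp only [List.tail_cons] at htail
    intro hw
    simp only [List.map_cons, List.map_append, List.map_nil, List.prod_cons, List.prod_append,
      List.prod_nil, mul_one] at hw
    obtain rfl | rfl := Bool.eq_or_eq_not j i
    · have hu : u ≠ [] := by
        rintro rfl
        simp at hchain
      have hw' : (u.map Prod.snd).prod * (b * a) = 1 := by
        rw [← mul_assoc]
        exact mul_eq_one_comm.1 hw
      by_cases hba : b * a = 1
      · rw [hba, mul_one] at hw'
        exact ih u.length (by simp) u hu (fun p hp => hmem p (by simp [hp]))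
          (htail.left_of_append) rfl hw'
      · refine ih (u ++ [(j, b * a)]).length (by simp) (u ++ [(j, b * a)]) (by simp) ?_ ?_ rfl
          (by simpa using hw')
        · intro p hp
          rcases List.mem_append.1 hp with hp | hp
          · exact hmem p (by simp [hp])
          · obtain rfl := List.mem_singleton.1 hp
            exact ⟨mul_mem hb ha, hba⟩
        · simpa [List.isChain_append] using htail
    · have h := apply_prod_eq_of_suffixes_ne_one hf i b hb u
        (fun p hp => (hmem p (by simp [hp])).1) (fun t ht => ?_) (!i)
      · rw [← ha, hw] at h
        exact hf1 i h.symm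
      · have hsuf : t ++ [(i, b)] <:+ u ++ [(i, b)] := by
          obtain ⟨r, rfl⟩ := ht
          exact ⟨r, by simp⟩
        have := ih (t ++ [(i, b)]).length (by have := hsuf.length_le; simp at this ⊢; omega)
          (t ++ [(i, b)]) (by simp)
          (fun p hp => hmem p (List.mem_cons_of_mem _ (hsuf.subset hp)))
          (htail.suffix hsuf) rfl
        simpa using this

/-- If `G` does not contain a nontrivial free product and `α, β : G → X` differ at a
unique point, then at most one of them has a nontrivial stabilizer for the action
`(g • α) h = α (g⁻¹ h)`. -/
theorem stmt_1 {G : Type*} [Group G]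
    (hG : ∀ A B : Subgroup G, A ≠ ⊥ → B ≠ ⊥ →
      ¬ Function.Injective (Monoid.Coprod.lift A.subtype B.subtype))
    {X : Type*} (α β : G → X)
    (huniq : ∃! g₀ : G, α g₀ ≠ β g₀)
    (hα : ∃ g : G, g ≠ 1 ∧ ∀ h : G, α (g⁻¹ * h) = α h) :
    ∀ g : G, (∀ h : G, β (g⁻¹ * h) = β h) → g = 1 := by
  obtain ⟨g₀, hg₀, huniq⟩ := huniq
  obtain ⟨a, ha1, ha⟩ := hα
  intro b hb
  by_contra hb1
  let f : Bool → G → X := fun i h => (bif i then α else β) (h * g₀)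
  have hf : ∀ h, h ≠ 1 → α (h * g₀) = β (h * g₀) := by
    intro h hh
    by_contra hne
    exact hh (by simpa using huniq _ hne)
  refine hG (leftTranslationStabilizer (f true)) (leftTranslationStabilizer (f false)) ?_ ?_
    (coprod_lift_subtype_injective (fun i => leftTranslationStabilizer (f i))
      (reduced_word_prod_ne_one ?_ ?_))
  · refine Subgroup.ne_bot_iff_exists_ne_one.2 ⟨⟨a⁻¹, fun h => ?_⟩, ?_⟩
    · simpa [f, mul_assoc] using ha (h * g₀)
    · simpa [Subtype.ext_iff] using ha1
  · refine Subgroup.ne_bot_iff_exists_ne_one.2 ⟨⟨b⁻¹, fun h => ?_⟩, ?_⟩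
    · simpa [f, mul_assoc] using hb (h * g₀)
    · simpa [Subtype.ext_iff] using hb1
  · rintro (_ | _) h hh
    · exact (hf h hh).symm
    · exact hf h hh
  · rintro (_ | _)
    · simpa [f] using hg₀.symm
    · simpa [f] using hg₀
end

section
/- Let G be a commutative group, let X be a set, and let G act on the set X^G of functions G → X by (g·α)(h) = α(g⁻¹h). Suppose α, β : G → X are such that there exists a unique g₀ ∈ G with α(g₀) ≠ β(g₀). If the stabilizer of α in G is nontrivial, then the stabilizer of β in G is trivial. -/
/-- If `G` is commutative and `α, β : G → X` differ at a unique point, then at most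
one of them has a nontrivial stabilizer for the action `(g • α) h = α (g⁻¹ h)`. -/
theorem stmt_2 {G : Type*} [CommGroup G]
    {X : Type*} (α β : G → X)
    (huniq : ∃! g₀ : G, α g₀ ≠ β g₀)
    (hα : ∃ g : G, g ≠ 1 ∧ ∀ h : G, α (g⁻¹ * h) = α h) :
    ∀ g : G, (∀ h : G, β (g⁻¹ * h) = β h) → g = 1 := by
  obtain ⟨c, hc, hu⟩ := huniq
  obtain ⟨a, ha, hαa⟩ := hα
  intro b hβb
  by_contra hb
  have agree (g : G) (hg : g ≠ 1) : α (g * c) = β (g * c) := by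
    by_contra hne
    exact hg (mul_eq_right.mp (hu _ hne))
  have hαa' (h : G) : α (a * h) = α h := by
    simpa using (hαa (a * h)).symm
  have hβb' (h : G) : β (b * h) = β h := by
    simpa using (hβb (b * h)).symm
  by_cases hab : a * b = 1
  · apply hc
    rw [← hβb' c, ← agree b hb, eq_inv_of_mul_eq_one_right hab, hαa c]
  · apply hc
    calc
      α c = β (a * c) := by rw [← agree a ha, hαa']
      _ = β (a * b * c) := by rw [mul_comm a b, mul_assoc, hβb']
      _ = α (b * c) := by rw [← agree _ hab, mul_assoc, hαa']
      _ = β c := by rw [agree b hb, hβb']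
end

section
/- Let G be a group containing a nontrivial free product: there exist nontrivial subgroups A, B of G such that the canonical homomorphism from the free product A ∗ B to G induced by the inclusions is injective. Let G act on the set G^G of functions G → G by (g·α)(h) = α(g⁻¹h). Then there exist functions α, β : G → G such that there is a unique g₀ ∈ G with α(g₀) ≠ β(g₀), the stabilizer of α contains A, and the stabilizer of β contains B; in particular both stabilizers are nontrivial. -/
open Monoid Function

/-- Left translation of the first factor of `G × G`. -/
def mulLeftFst (G : Type*) [Group G] : G →* Equiv.Perm (G × G) where
  toFun g := (Equiv.mulLeft g).prodCongr (Equiv.refl G)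
  map_one' := by ext p <;> simp
  map_mul' g h := by ext p <;> simp [mul_assoc]

@[simp]
theorem mulLeftFst_apply {G : Type*} [Group G] (g : G) (p : G × G) :
    mulLeftFst G g p = (g * p.1, p.2) := rfl

theorem swap_apply_fst {X Y : Type*} [DecidableEq (X × Y)] (x : X) (y z : Y) (p : X × Y) :
    (Equiv.swap (x, y) (x, z) p).1 = p.1 := by
  rw [Equiv.swap_apply_def]
  split_ifs <;> simp_all

/-- Extending a function along an injective homomorphism preserves left invariance. -/
theorem extend_mul_left {H G X : Type*} [Group H] [Group G] {φ : H →* G} (hφ : Injective φ)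
    {F : H → X} {k : H} (hF : ∀ w, F (k * w) = F w) (c : X) (g : G) :
    extend φ F (fun _ => c) (φ k * g) = extend φ F (fun _ => c) g := by
  by_cases hg : ∃ w, φ w = g
  · obtain ⟨w, rfl⟩ := hg
    rw [← map_mul, hφ.extend_apply, hφ.extend_apply, hF]
  · rw [extend_apply' _ _ _ hg, extend_apply']
    rintro ⟨w, hw⟩
    exact hg ⟨k⁻¹ * w, by simp [hw]⟩

/-- If `G` contains the nontrivial free product of two subgroups `A` and `B`, then
there exist `α, β : G → G` differing at a unique point whose stabilizers (for the
action `(g • α) h = α (g⁻¹ h)`) contain `A` resp. `B`; in particular both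
stabilizers are nontrivial. -/
theorem stmt_3 {G : Type*} [Group G]
    (A B : Subgroup G) (hA : A ≠ ⊥) (hB : B ≠ ⊥)
    (hinj : Function.Injective (Monoid.Coprod.lift A.subtype B.subtype)) :
    ∃ α β : G → G, (∃! g₀ : G, α g₀ ≠ β g₀) ∧
      (∀ a ∈ A, ∀ h : G, α (a⁻¹ * h) = α h) ∧
      (∀ b ∈ B, ∀ h : G, β (b⁻¹ * h) = β h) ∧
      (∃ g : G, g ≠ 1 ∧ ∀ h : G, α (g⁻¹ * h) = α h) ∧
      (∃ g : G, g ≠ 1 ∧ ∀ h : G, β (g⁻¹ * h) = β h) := by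
  classical
  obtain ⟨x, hxA, hx⟩ := A.bot_or_exists_ne_one.resolve_left hA
  obtain ⟨y, hyB, hy⟩ := B.bot_or_exists_ne_one.resolve_left hB
  set φ := Coprod.lift A.subtype B.subtype
  let τ : Equiv.Perm (G × G) := Equiv.swap (1, 1) (1, x)
  -- `A` translates the first factor and `B` does so up to conjugation by `τ`.
  let ρ : Coprod A B →* Equiv.Perm (G × G) :=
    Coprod.lift ((mulLeftFst G).comp A.subtype)
      ((MulAut.conj τ).toMonoidHom.comp ((mulLeftFst G).comp B.subtype))
  have hτ (p) : (τ p).1 = p.1 := swap_apply_fst _ _ _ p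
  have hττ (p) : τ (τ p) = p := Equiv.swap_apply_self _ _ p
  have hτinv : τ⁻¹ = τ := Equiv.swap_inv _ _
  have hρA (a : A) (p) : ρ (Coprod.inl a) p = (a * p.1, p.2) := by simp [ρ]
  have hρB (b : B) (p) : ρ (Coprod.inr b) p = τ (b * p.1, (τ p).2) := by
    simp [ρ, hτinv, hτ]
  have hfst (w) : ∀ p, (ρ w p).1 = φ w * p.1 := by
    induction w using Coprod.induction_on with
    | inl a => intro p; simp [hρA, φ]
    | inr b => intro p; simp [hρB, hτ, φ]
    | mul v w hv hw => intro p; simp [hv, hw, mul_assoc]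
  let F : Coprod A B → G := fun w => (ρ w (1, 1)).2
  let F' : Coprod A B → G := fun w => (τ (ρ w (1, 1))).2
  have hα : ∀ a ∈ A, ∀ h, extend φ F (fun _ => 1) (a⁻¹ * h) = extend φ F (fun _ => 1) h := by
    intro a ha h
    simpa [φ] using extend_mul_left hinj (F := F) (k := Coprod.inl (⟨a, ha⟩⁻¹ : A))
      (fun w => by simp only [F, map_mul, Equiv.Perm.mul_apply, hρA]) 1 h
  have hβ : ∀ b ∈ B, ∀ h, extend φ F' (fun _ => 1) (b⁻¹ * h) = extend φ F' (fun _ => 1) h := by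
    intro b hb h
    simpa [φ] using extend_mul_left hinj (F := F') (k := Coprod.inr (⟨b, hb⟩⁻¹ : B))
      (fun w => by simp only [F', map_mul, Equiv.Perm.mul_apply, hρB, hττ]) 1 h
  refine ⟨extend φ F fun _ => 1, extend φ F' fun _ => 1, ⟨1, ?_, ?_⟩, hα, hβ,
    ⟨x, hx, hα x hxA⟩, ⟨y, hy, hβ y hyB⟩⟩
  · change extend φ F _ 1 ≠ extend φ F' _ 1
    rw [← map_one φ, hinj.extend_apply, hinj.extend_apply]
    simpa [F, F', τ] using hx.symm
  · intro g hg
    by_contra hg1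
    apply hg
    by_cases hw : ∃ w, φ w = g
    · obtain ⟨w, rfl⟩ := hw
      rw [hinj.extend_apply, hinj.extend_apply]
      have hne (z : G) : ρ w (1, 1) ≠ (1, z) := fun h =>
        hg1 (by simpa [h] using (hfst w (1, 1)).symm)
      simp only [F, F', τ, Equiv.swap_apply_of_ne_of_ne (hne 1) (hne x)]
    · rw [extend_apply' _ _ _ hw, extend_apply' _ _ _ hw]
end

section
/- Let Γ be a finite cyclic group with generator γ acting freely on a finite set X, and let Y be a set with at least 2 elements. Let c : X → Y. Suppose there exists a Γ-orbit 𝒪 in X such that (a) c is constant on every Γ-orbit P ≠ 𝒪, and (b) there exist u, v ∈ 𝒪 with u ≠ v such that c is constant on the interval [v,u]_γ and constant on its complement 𝒪 \ [v,u]_γ. Then there exist α, β : X → Y with α ≠ β, α ⊥ c, β ⊥ c and β = γ·α. -/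
/-- (ii) ⇒ (i) of the basic necklace lemma: if `c : X → Y` is constant on all
`Γ`-orbits but one, on which it is constant on an interval `[v,u]_γ` and on its
complement, then there exist `α ≠ β` with `α ⊥ c`, `β ⊥ c` and `β = γ·α`. -/
theorem stmt_4 {Γ X Y : Type*} [Group Γ] [Fintype Γ] [MulAction Γ X] [Fintype X]
    (hfree : ∀ (g : Γ) (x : X), g • x = x → g = 1)
    (γ : Γ) (hγ : Subgroup.zpowers γ = ⊤)
    (hY : ∃ y₁ y₂ : Y, y₁ ≠ y₂)
    (c : X → Y)
    (h : ∃ v u : X, u ∈ MulAction.orbit Γ v ∧ u ≠ v ∧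
      (∀ x : X, MulAction.orbit Γ x ≠ MulAction.orbit Γ v →
        ∀ y ∈ MulAction.orbit Γ x, ∀ z ∈ MulAction.orbit Γ x, c y = c z) ∧
      (∃ r : ℕ, r < orderOf γ ∧ u = γ ^ r • v ∧
        (∀ k ≤ r, ∀ l ≤ r, c (γ ^ k • v) = c (γ ^ l • v)) ∧
        (∀ y ∈ MulAction.orbit Γ v \ {x | ∃ k ≤ r, x = γ ^ k • v},
          ∀ z ∈ MulAction.orbit Γ v \ {x | ∃ k ≤ r, x = γ ^ k • v}, c y = c z))) :
    ∃ α β : X → Y, α ≠ β ∧ (∃! x : X, α x ≠ c x) ∧ (∃! x : X, β x ≠ c x) ∧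
      (∀ x : X, β x = α (γ⁻¹ • x)) := by
  classical
  obtain ⟨v, u, -, huv, hconst, r, hr, rfl, hin, hout⟩ := h
  have hinj : ∀ i j : ℕ, i < orderOf γ → j < orderOf γ → γ ^ i • v = γ ^ j • v → i = j := by
    intro i j hi hj hij
    refine pow_injOn_Iio_orderOf hi hj (inv_mul_eq_one.mp (hfree _ v ?_)).symm
    rw [mul_smul, hij, inv_smul_smul]
  have hr0 : r ≠ 0 := by
    rintro rfl
    simp at huv
  have hlow : ∀ k ≤ r, c (γ ^ k • v) = c v := by
    intro k hk
    simpa using hin k hk 0 (Nat.zero_le _)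
  have hmem : ∀ k, r < k → k < orderOf γ →
      γ ^ k • v ∈ MulAction.orbit Γ v \ {x | ∃ k ≤ r, x = γ ^ k • v} := by
    rintro k hk hkn
    refine ⟨⟨_, rfl⟩, ?_⟩
    rintro ⟨j, hj, hjk⟩
    have := hinj k j hkn (by omega) hjk
    omega
  have hhigh : ∀ k, r < k → k < orderOf γ → c (γ ^ k • v) = c (γ ^ (r + 1) • v) := by
    intro k hk hkn
    exact hout _ (hmem k hk hkn) _ (hmem _ (by omega) (by omega))
  have horb : ∀ x ∈ MulAction.orbit Γ v, ∃ k < orderOf γ, x = γ ^ k • v := by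
    rintro _ ⟨g, rfl⟩
    have hg : g ∈ Subgroup.zpowers γ := hγ ▸ Subgroup.mem_top g
    rw [mem_zpowers_iff_mem_range_orderOf] at hg
    obtain ⟨k, hk, rfl⟩ := Finset.mem_image.mp hg
    rw [Finset.mem_range] at hk
    exact ⟨k, hk, rfl⟩
  have hoff : ∀ x ∉ MulAction.orbit Γ v, c (γ⁻¹ • x) = c x := by
    intro x hx
    refine hconst x (fun h => hx (h ▸ MulAction.mem_orbit_self x)) _ ⟨γ⁻¹, rfl⟩ _
      (MulAction.mem_orbit_self x)
  have hpred : ∀ k, γ⁻¹ • γ ^ (k + 1) • v = γ ^ k • v := by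
    intro k
    rw [inv_smul_eq_iff, smul_smul, pow_succ']
  have hγv : γ • v ≠ v := by
    intro hv
    have := hfree γ v hv
    rw [this, orderOf_one] at hr
    omega
  by_cases hb : c (γ ^ (r + 1) • v) = c v
  · have hall : ∀ x ∈ MulAction.orbit Γ v, c x = c v := by
      intro x hx
      obtain ⟨k, hk, rfl⟩ := horb x hx
      rcases le_or_gt k r with hkr | hkr
      · exact hlow k hkr
      · exact (hhigh k hkr hk).trans hb
    have hinv : ∀ x, c (γ⁻¹ • x) = c x := by
      intro x
      by_cases hx : x ∈ MulAction.orbit Γ v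
      · rw [hall x hx, hall _ (MulAction.mem_orbit_of_mem_orbit γ⁻¹ hx)]
      · exact hoff x hx
    obtain ⟨y, hy⟩ : ∃ y, y ≠ c v := by
      obtain ⟨y₁, y₂, hy⟩ := hY
      by_cases h₁ : y₁ = c v
      · exact ⟨y₂, fun h₂ => hy (h₁.trans h₂.symm)⟩
      · exact ⟨y₁, h₁⟩
    have hα : ∀ x, Function.update c v y x ≠ c x ↔ x = v := by
      intro x
      by_cases hx : x = v
      · subst hx; simpa using hy
      · simp [hx]
    refine ⟨Function.update c v y, fun x => Function.update c v y (γ⁻¹ • x), ?_,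
      ⟨v, (hα v).2 rfl, fun x => (hα x).1⟩, ⟨γ • v, ?_, ?_⟩, fun _ => rfl⟩
    · intro h
      have h' := congrFun h (γ • v)
      simp only [inv_smul_smul, Function.update_self, Function.update_of_ne hγv] at h'
      exact hy (h'.symm.trans (hall _ ⟨γ, rfl⟩))
    · simpa [hall _ ⟨γ, rfl⟩] using hy
    · intro x hx
      rw [← hinv x] at hx
      exact inv_smul_eq_iff.mp ((hα _).1 hx)
  · have hrn : r + 1 < orderOf γ := by
      refine lt_of_le_of_ne hr fun h => hb ?_
      rw [h, pow_orderOf_eq_one, one_smul]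
    have hlast : c (γ⁻¹ • v) = c (γ ^ (r + 1) • v) := by
      have h := hpred (orderOf γ - 1)
      rw [Nat.sub_add_cancel (by omega), pow_orderOf_eq_one, one_smul] at h
      rw [h]
      exact hhigh _ (by omega) (by omega)
    have hne : γ⁻¹ • v ≠ γ ^ r • v := by
      intro h
      rw [h, hlow r le_rfl] at hlast
      exact hb hlast.symm
    refine ⟨Function.update c (γ ^ r • v) (c (γ ^ (r + 1) • v)),
      fun x => Function.update c (γ ^ r • v) (c (γ ^ (r + 1) • v)) (γ⁻¹ • x), ?_,
      ⟨γ ^ r • v, ?_, ?_⟩, ⟨v, ?_, ?_⟩, fun _ => rfl⟩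
    · intro h
      have h' := congrFun h v
      simp only [Function.update_of_ne hne, Function.update_of_ne huv.symm, hlast] at h'
      exact hb h'.symm
    · simpa [hlow r le_rfl] using hb
    · intro x hx
      by_contra hxu
      exact hx (Function.update_of_ne hxu _ _)
    · simpa [Function.update_of_ne hne, hlast] using hb
    · intro x hx
      by_contra hxv
      apply hx
      by_cases hxo : x ∈ MulAction.orbit Γ v
      · obtain ⟨k, hk, rfl⟩ := horb x hxo
        obtain _ | k := k
        · simp at hxv
        simp only [hpred]
        by_cases hkr : k = r
        · subst hkr; simp
        rw [Function.update_of_ne fun h => hkr (hinj k r (by omega) hr h)]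
        rcases lt_or_gt_of_ne hkr with hlt | hgt
        · rw [hlow k hlt.le, hlow (k + 1) hlt]
        · rw [hhigh k hgt (by omega), hhigh (k + 1) (by omega) hk]
      · have hxu : γ⁻¹ • x ≠ γ ^ r • v := by
          intro h
          refine hxo ⟨γ ^ (r + 1), ?_⟩
          rw [inv_smul_eq_iff] at h
          simp [h, smul_smul, pow_succ']
        simp only [Function.update_of_ne hxu]
        exact hoff x hxo
end

section
/- Let Γ be a finite cyclic group with generator γ acting freely on a finite set X, let Y be a set with at least 2 elements, and let c : X → Y. Suppose there exist α, β : X → Y with α ≠ β, α ⊥ c, β ⊥ c and β = γ·α. Then there exists a Γ-orbit 𝒪 in X such that (a) c is constant on every Γ-orbit P ≠ 𝒪, and (b) there exist u, v ∈ 𝒪 with u ≠ v such that c is constant on the interval [v,u]_γ and constant on its complement 𝒪 \ [v,u]_γ; moreover u and v may be taken to be the unique points with α(u) ≠ c(u) and β(v) ≠ c(v). -/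
theorem pow_smul_ne_pow_smul {Γ X : Type*} [Group Γ] [MulAction Γ X]
    (hfree : ∀ (g : Γ) (x : X), g • x = x → g = 1) (γ : Γ) (x : X) {i j : ℕ}
    (hi : i < orderOf γ) (hj : j < orderOf γ) (hij : i ≠ j) : γ ^ i • x ≠ γ ^ j • x := by
  intro h
  have h1 : ((γ ^ j)⁻¹ * γ ^ i) • x = x := by rw [mul_smul, h, inv_smul_smul]
  exact hij (pow_injOn_Iio_orderOf hi hj (inv_mul_eq_one.mp (hfree _ _ h1)).symm)

theorem exists_pow_smul_of_mem_orbit {Γ X : Type*} [Group Γ] [Finite Γ] [MulAction Γ X]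
    {γ : Γ} (hγ : Subgroup.zpowers γ = ⊤) {x y : X} (hy : y ∈ MulAction.orbit Γ x) :
    ∃ k < orderOf γ, y = γ ^ k • x := by
  classical
  obtain ⟨g, rfl⟩ := hy
  have hg : g ∈ Subgroup.zpowers γ := hγ ▸ Subgroup.mem_top g
  obtain ⟨k, hk, rfl⟩ := ((isOfFinOrder_of_finite γ).mem_zpowers_iff_mem_range_orderOf.trans
    (by simp : _ ↔ ∃ k < orderOf γ, γ ^ k = g)).mp hg
  exact ⟨k, hk, rfl⟩

theorem apply_pow_smul_eq_of_step {Γ X Y : Type*} [Monoid Γ] [MulAction Γ X] {γ : Γ} {x : X}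
    {c : X → Y} {a b : ℕ}
    (h : ∀ k, a ≤ k → k < b → c (γ • γ ^ k • x) = c (γ ^ k • x)) (k : ℕ) (hak : a ≤ k)
    (hkb : k ≤ b) : c (γ ^ k • x) = c (γ ^ a • x) := by
  induction k, hak using Nat.le_induction with
  | base => rfl
  | succ k hk ih => rw [pow_succ', mul_smul, h k hk (by omega), ih (by omega)]

/-- (i) ⇒ (ii) of the basic necklace lemma: if there exist `α ≠ β` with `α ⊥ c`,
`β ⊥ c` and `β = γ·α`, then `c` is constant on all `Γ`-orbits but one, on which it
is constant on an interval `[v,u]_γ` and on its complement, where `u` and `v` are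
the unique points with `α u ≠ c u` and `β v ≠ c v`. -/
theorem stmt_5 {Γ X Y : Type*} [Group Γ] [Fintype Γ] [MulAction Γ X] [Fintype X]
    (hfree : ∀ (g : Γ) (x : X), g • x = x → g = 1)
    (γ : Γ) (hγ : Subgroup.zpowers γ = ⊤)
    (hY : ∃ y₁ y₂ : Y, y₁ ≠ y₂)
    (c α β : X → Y) (hαβ : α ≠ β)
    (hαc : ∃! x : X, α x ≠ c x) (hβc : ∃! x : X, β x ≠ c x)
    (hβ : ∀ x : X, β x = α (γ⁻¹ • x)) :
    ∃ u v : X, α u ≠ c u ∧ β v ≠ c v ∧ u ≠ v ∧ u ∈ MulAction.orbit Γ v ∧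
      (∀ x : X, MulAction.orbit Γ x ≠ MulAction.orbit Γ v →
        ∀ y ∈ MulAction.orbit Γ x, ∀ z ∈ MulAction.orbit Γ x, c y = c z) ∧
      (∃ r : ℕ, r < orderOf γ ∧ u = γ ^ r • v ∧
        (∀ k ≤ r, ∀ l ≤ r, c (γ ^ k • v) = c (γ ^ l • v)) ∧
        (∀ y ∈ MulAction.orbit Γ v \ {x | ∃ k ≤ r, x = γ ^ k • v},
          ∀ z ∈ MulAction.orbit Γ v \ {x | ∃ k ≤ r, x = γ ^ k • v}, c y = c z)) := by
  obtain ⟨u, hu, hu'⟩ := hαc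
  obtain ⟨v, hv, hv'⟩ := hβc
  have hα_eq : ∀ x, x ≠ u → α x = c x := fun x hx => by_contra fun h => hx (hu' x h)
  have hβ_eq : ∀ x, x ≠ v → β x = c x := fun x hx => by_contra fun h => hx (hv' x h)
  have hβγ : ∀ x, β (γ • x) = α x := fun x => by rw [hβ, inv_smul_smul]
  have step : ∀ x, x ≠ u → γ • x ≠ v → c (γ • x) = c x := fun x h1 h2 => by
    rw [← hβ_eq _ h2, hβγ, hα_eq _ h1]
  have hpos : 0 < orderOf γ := orderOf_pos γ
  have hγ1 : γ ≠ 1 := by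
    rintro rfl
    exact hαβ (funext fun x => by simp [hβ])
  have hn : 1 < orderOf γ := by
    have := mt orderOf_eq_one_iff.mp hγ1
    omega
  have hne_pow : ∀ (x : X) (k : ℕ), 1 ≤ k → k < orderOf γ → γ ^ k • x ≠ x := fun x k h1 h2 => by
    simpa using pow_smul_ne_pow_smul hfree γ x h2 hpos (by omega)
  have huv : u ≠ v := by
    rintro rfl
    have hγu : γ • u ≠ u := fun h => hγ1 (hfree _ _ h)
    have hconst := apply_pow_smul_eq_of_step (γ := γ) (x := u) (c := c) (a := 1)
      (b := orderOf γ - 1) (fun k h1 h2 => step _ (hne_pow u k h1 (by omega)) (by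
        rw [smul_smul, ← pow_succ']
        exact hne_pow u (k + 1) (by omega) (by omega))) (orderOf γ - 1) (by omega) le_rfl
    have hinv : γ ^ (orderOf γ - 1) = γ⁻¹ := by
      rw [eq_inv_iff_mul_eq_one, ← pow_succ, Nat.sub_add_cancel hpos, pow_orderOf_eq_one]
    rw [hinv, pow_one] at hconst
    have hβu : β u = α u := by
      rw [hβ, hα_eq _ (fun h => hγu (by rw [eq_comm, ← inv_smul_eq_iff, h])), hconst,
        ← hβ_eq _ hγu, hβγ]
    refine hαβ (funext fun x => ?_)
    by_cases hx : x = u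
    · rw [hx, hβu]
    · rw [hα_eq x hx, hβ_eq x hx]
  have horb : u ∈ MulAction.orbit Γ v := by
    by_contra hnot
    have hnev : ∀ g : Γ, g • u ≠ v := fun g h => hnot ⟨g⁻¹, by simp [← h]⟩
    have hconst := apply_pow_smul_eq_of_step (γ := γ) (x := u) (c := c) (a := 1)
      (b := orderOf γ) (fun k h1 h2 => step _ (hne_pow u k h1 h2) (by
        rw [smul_smul]
        exact hnev _)) (orderOf γ) hn.le le_rfl
    rw [pow_orderOf_eq_one, one_smul, pow_one, ← hβ_eq _ (hnev γ), hβγ] at hconst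
    exact hu hconst.symm
  refine ⟨u, v, hu, hv, huv, horb, ?_, ?_⟩
  · intro x hx
    have hnev : ∀ g : Γ, g • x ∉ MulAction.orbit Γ v := fun g h =>
      hx (by rw [← MulAction.orbit_eq_iff.mpr h, MulAction.orbit_smul])
    have hconst : ∀ y ∈ MulAction.orbit Γ x, c y = c x := by
      intro y hy
      obtain ⟨k, -, rfl⟩ := exists_pow_smul_of_mem_orbit hγ hy
      simpa using apply_pow_smul_eq_of_step (γ := γ) (x := x) (c := c) (a := 0) (b := k)
        (fun j _ _ => step _ (fun h => hnev _ (h ▸ horb)) (fun h => by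
          rw [smul_smul] at h
          exact hnev (γ * γ ^ j) (by rw [h]; exact MulAction.mem_orbit_self v))) k (Nat.zero_le k) le_rfl
    intro y hy z hz
    rw [hconst y hy, hconst z hz]
  · obtain ⟨r, hr, hur⟩ := exists_pow_smul_of_mem_orbit hγ horb
    have hstep : ∀ k, k ≠ r → k + 1 < orderOf γ → c (γ • γ ^ k • v) = c (γ ^ k • v) := by
      intro k hk hk'
      refine step _ ?_ ?_
      · rw [hur]
        exact pow_smul_ne_pow_smul hfree γ v (by omega) hr hk
      · rw [smul_smul, ← pow_succ']
        exact hne_pow v (k + 1) (by omega) hk'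
    refine ⟨r, hr, hur, ?_, ?_⟩
    · have hconst := apply_pow_smul_eq_of_step (γ := γ) (x := v) (c := c) (a := 0) (b := r)
        (fun k _ h => hstep k h.ne (by omega))
      intro k hk l hl
      rw [hconst k (Nat.zero_le k) hk, hconst l (Nat.zero_le l) hl]
    · have hconst : ∀ y ∈ MulAction.orbit Γ v \ {x | ∃ k ≤ r, x = γ ^ k • v},
          c y = c (γ ^ (r + 1) • v) := by
        rintro y ⟨hy, hyr⟩
        obtain ⟨k, hk, rfl⟩ := exists_pow_smul_of_mem_orbit hγ hy
        have hrk : r < k := not_le.mp fun h => hyr ⟨k, h, rfl⟩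
        exact apply_pow_smul_eq_of_step (γ := γ) (x := v) (c := c) (a := r + 1) (b := k)
          (fun j h1 h2 => hstep j (by omega) (by omega)) k hrk le_rfl
      intro y hy z hz
      rw [hconst y hy, hconst z hz]
end

section
/- Let Γ be a finite cyclic group with generator γ acting freely on a finite set X, let Y be a set with at least 2 elements, and let c, α, β : X → Y satisfy α ≠ β, α ⊥ c, β ⊥ c and β = γ·α. Let u be the unique point with α(u) ≠ c(u), let v be the unique point with β(v) ≠ c(v), and let 𝒪 = Γ·u. Then v ∈ 𝒪, the following are equivalent: (i) γ lies in the stabilizer Aut(c) of c, (ii) c is constant on 𝒪, (iii) v = γ·u; and moreover the image sets α(𝒪) and β(𝒪) have the same cardinality. -/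
/-- A function on a finite type whose precomposition with a permutation agrees with it away from
one point also agrees with it at that point. -/
theorem apply_perm_eq_of_forall_ne {X Y : Type*} [Fintype X] (σ : Equiv.Perm X) (f : X → Y)
    (a : X) (h : ∀ x, x ≠ a → f (σ x) = f x) : f (σ a) = f a := by
  classical
  have hmap : (Finset.univ : Finset X).val.map (fun x => f (σ x)) = Finset.univ.val.map f := by
    conv_rhs => rw [← Finset.map_univ_equiv σ, Finset.map_val, Multiset.map_map]
    rfl
  have hcons : (Finset.univ : Finset X).val = a ::ₘ (Finset.univ.erase a).val := by
    rw [Finset.erase_val, Multiset.cons_erase (Finset.mem_univ_val a)]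
  have hrest : (Finset.univ.erase a).val.map (fun x => f (σ x)) =
      (Finset.univ.erase a).val.map f :=
    Multiset.map_congr rfl fun x hx => h x (Finset.ne_of_mem_erase hx)
  rw [hcons, Multiset.map_cons, Multiset.map_cons, hrest] at hmap
  exact (Multiset.cons_inj_left _).1 hmap


/-- Complements to the basic necklace lemma: with `α ≠ β`, `α ⊥ c`, `β ⊥ c`,
`β = γ·α`, `u` the unique point with `α u ≠ c u`, `v` the unique point with
`β v ≠ c v`, and `𝒪 = Γ·u`, we have `v ∈ 𝒪`, and
`γ ∈ Aut(c) ↔ c` is constant on `𝒪` `↔ v = γ·u`; moreover `|α(𝒪)| = |β(𝒪)|`. -/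
theorem stmt_6 {Γ X Y : Type*} [Group Γ] [Fintype Γ] [MulAction Γ X] [Fintype X]
    (hfree : ∀ (g : Γ) (x : X), g • x = x → g = 1)
    (γ : Γ) (hγ : Subgroup.zpowers γ = ⊤)
    (hY : ∃ y₁ y₂ : Y, y₁ ≠ y₂)
    (c α β : X → Y) (hαβ : α ≠ β)
    (hαc : ∃! x : X, α x ≠ c x) (hβc : ∃! x : X, β x ≠ c x)
    (hβ : ∀ x : X, β x = α (γ⁻¹ • x))
    (u v : X) (hu : α u ≠ c u) (hv : β v ≠ c v) :
    v ∈ MulAction.orbit Γ u ∧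
    ((∀ x : X, c (γ⁻¹ • x) = c x) ↔
      (∀ y ∈ MulAction.orbit Γ u, ∀ z ∈ MulAction.orbit Γ u, c y = c z)) ∧
    ((∀ x : X, c (γ⁻¹ • x) = c x) ↔ v = γ • u) ∧
    (α '' MulAction.orbit Γ u).ncard = (β '' MulAction.orbit Γ u).ncard := by

  classical
  have hαc' : ∀ x, x ≠ u → α x = c x := fun x hx => by
    by_contra h
    exact hx (hαc.unique h hu)
  have hβc' : ∀ x, x ≠ v → β x = c x := fun x hx => by
    by_contra h
    exact hx (hβc.unique h hv)
  have hmem (x : X) : γ⁻¹ • x ∈ MulAction.orbit Γ u ↔ x ∈ MulAction.orbit Γ u := by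
    conv_lhs => rw [← MulAction.smul_orbit γ⁻¹ u, Set.smul_mem_smul_set_iff]
  have hv_mem : v ∈ MulAction.orbit Γ u := by
    by_contra hvO
    have huv : u ≠ v := by
      rintro rfl
      exact hvO (MulAction.mem_orbit_self u)
    have key := apply_perm_eq_of_forall_ne (MulAction.toPerm γ⁻¹)
      (fun x => if x ∈ MulAction.orbit Γ u then some (α x) else none) u fun x hx => by
        by_cases hxO : x ∈ MulAction.orbit Γ u
        · have hxv : x ≠ v := fun h => hvO (h ▸ hxO)
          simp only [MulAction.toPerm_apply, hmem, hxO, if_true]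
          rw [← hβ, hβc' x hxv, hαc' x hx]
        · simp only [MulAction.toPerm_apply, hmem, hxO, if_false]
    simp only [MulAction.toPerm_apply, hmem, MulAction.mem_orbit_self, if_true,
      Option.some.injEq] at key
    rw [← hβ, hβc' u huv] at key
    exact hu key.symm
  have hstep : ∀ x, x ≠ γ • u → x ≠ v → c (γ⁻¹ • x) = c x := fun x hxu hxv => by
    rw [← hαc' _ fun h => hxu (inv_smul_eq_iff.1 h), ← hβ, hβc' x hxv]
  refine ⟨hv_mem, ⟨fun h => ?_, fun h x => ?_⟩, ⟨fun h => ?_, ?_⟩, ?_⟩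
  · have hle : Subgroup.zpowers γ ≤
        { carrier := {g : Γ | ∀ x, c (g • x) = c x}
          one_mem' := fun x => by rw [one_smul]
          mul_mem' := fun {a b} ha hb x => by rw [mul_smul, ha, hb]
          inv_mem' := fun {a} ha x => by rw [← ha (a⁻¹ • x), smul_inv_smul] : Subgroup Γ } := by
      rw [Subgroup.zpowers_le]
      intro x
      rw [← h (γ • x), inv_smul_smul]
    rw [hγ] at hle
    rintro _ ⟨g, rfl⟩ _ ⟨k, rfl⟩
    exact (hle (Subgroup.mem_top g) u).trans (hle (Subgroup.mem_top k) u).symm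
  · by_cases hx : x ∈ MulAction.orbit Γ u
    · exact h _ ((hmem x).2 hx) _ hx
    · refine hstep x ?_ ?_
      · rintro rfl
        exact hx (MulAction.mem_orbit u γ)
      · rintro rfl
        exact hx hv_mem
  · by_contra hne
    have := hβc' (γ • u) (Ne.symm hne)
    rw [hβ, inv_smul_smul, ← h (γ • u), inv_smul_smul] at this
    exact hu this
  · intro hvu x
    by_cases hx : x = v
    · subst hx
      exact apply_perm_eq_of_forall_ne (MulAction.toPerm γ⁻¹) c x
        fun y hy => hstep y (hvu ▸ hy) hy
    · exact hstep x (hvu ▸ hx) hx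
  · congr 1
    have hβα : β = α ∘ (γ⁻¹ • ·) := funext hβ
    rw [hβα, Set.image_comp, Set.image_smul, MulAction.smul_orbit]
end

section
/- Let n ≥ 3 and let m be an integer with 1 ≤ m ≤ n−3. Let I_m = {0̄, 1̄, …, m̄} ⊆ ℤ/nℤ, and let φ : ℤ/nℤ → ℤ/nℤ be a bijective affine map, i.e., φ(x) = a + b·x for some a, b ∈ ℤ/nℤ with b a unit. If φ(I_m) ⊆ I_m, then either φ is the identity, or φ(x) = m̄ − x for all x ∈ ℤ/nℤ. -/
/-- A natural number below `n` represents an element of `{0, …, m}` modulo `n` iff it is at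
most `m`. -/
theorem ZMod.natCast_mem_initial_iff {n m j : ℕ} (hm : m < n) (hj : j < n) :
    (j : ZMod n) ∈ {x : ZMod n | ∃ k ≤ m, x = (k : ZMod n)} ↔ j ≤ m := by
  constructor
  · rintro ⟨k, hk, h⟩
    rw [ZMod.natCast_eq_natCast_iff] at h
    have := h.eq_of_lt_of_lt hj (by omega)
    omega
  · exact fun h => ⟨j, h, rfl⟩

/-- If `n ≥ 3`, `1 ≤ m ≤ n - 3` and `φ` is a bijective affine map of `ℤ/nℤ`
with `φ(I_m) ⊆ I_m` where `I_m = {0̄, …, m̄}`, then `φ = id` or `φ(x) = m̄ - x`. -/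
theorem stmt_9 (n : ℕ) (hn : 3 ≤ n) (m : ℕ) (hm1 : 1 ≤ m) (hm2 : m ≤ n - 3)
    (φ : ZMod n → ZMod n) (a b : ZMod n) (hb : IsUnit b)
    (hφ : ∀ x : ZMod n, φ x = a + b * x)
    (hI : φ '' {x : ZMod n | ∃ k ≤ m, x = (k : ZMod n)} ⊆
      {x : ZMod n | ∃ k ≤ m, x = (k : ZMod n)}) :
    (∀ x : ZMod n, φ x = x) ∨ (∀ x : ZMod n, φ x = (m : ZMod n) - x) := by
  have : NeZero n := ⟨by omega⟩
  have : Fact (1 < n) := ⟨by omega⟩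
  have hmem : ∀ j : ℕ, j < n →
      ((j : ZMod n) ∈ {x : ZMod n | ∃ k ≤ m, x = (k : ZMod n)} ↔ j ≤ m) :=
    fun j hj => ZMod.natCast_mem_initial_iff (by omega) hj
  generalize {x : ZMod n | ∃ k ≤ m, x = (k : ZMod n)} = I at hI hmem
  have hinj : Function.Injective φ := fun x y h => by
    rw [hφ, hφ] at h
    exact hb.mul_left_cancel (add_left_cancel h)
  have himage : φ '' I = I :=
    Set.eq_of_subset_of_ncard_le hI (Set.ncard_image_of_injective I hinj).ge
  have hlast : φ m ∈ I := hI ⟨m, (hmem m (by omega)).2 le_rfl, rfl⟩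
  have hexit : φ m + b ∉ I := by
    intro h
    rw [← himage] at h
    obtain ⟨x, hx, hxm⟩ := h
    have : x = ((m + 1 : ℕ) : ZMod n) := hinj (by rw [hxm, hφ, hφ]; push_cast; ring)
    rw [this, hmem _ (by omega)] at hx
    omega
  have hunique : ∀ y ∈ I, y + b ∉ I → y = φ m := by
    intro y hy hyb
    rw [← himage] at hy
    obtain ⟨x, hx, rfl⟩ := hy
    have hxv : ((x.val : ℕ) : ZMod n) = x := ZMod.natCast_zmod_val x
    have hxm : x.val ≤ m := (hmem _ x.val_lt).1 (by rwa [hxv])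
    rcases hxm.eq_or_lt with h | h
    · rw [← h, hxv]
    · refine absurd (hI ⟨((x.val + 1 : ℕ) : ZMod n), (hmem _ (by omega)).2 h, ?_⟩) hyb
      rw [hφ, hφ]
      push_cast
      rw [hxv]
      ring
  obtain ⟨c, hc, rfl⟩ : ∃ c < n, b = (c : ZMod n) :=
    ⟨b.val, b.val_lt, (ZMod.natCast_zmod_val b).symm⟩
  have hstep : ∀ j ≤ m, m < j + c → j + c < n → (j : ZMod n) = φ m := by
    intro j hj h1 h2
    refine hunique _ ((hmem j (by omega)).2 hj) ?_
    rw [← Nat.cast_add, hmem _ h2]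
    omega
  have hno_two : ∀ j, j + 1 ≤ m → m < j + c → j + 1 + c < n → False := by
    intro j hj h1 h2
    have h := (hstep j (by omega) h1 (by omega)).trans (hstep (j + 1) hj (by omega) h2).symm
    simp at h
  have hc0 : c ≠ 0 := by
    rintro rfl
    simp at hb
  have hc' : c = 1 ∨ c = n - 1 := by
    by_contra! h
    by_cases hcm : c + m < n
    · exact hno_two (m - 1) (by omega) (by omega) (by omega)
    · exact hno_two (n - 2 - c) (by omega) (by omega) (by omega)
  rcases hc' with rfl | rfl
  · left
    have h := hstep m le_rfl (by omega) (by omega)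
    rw [hφ] at h
    have ha : a = 0 := by simpa using h
    intro x
    simp [hφ, ha]
  · right
    have h := hstep 0 (by omega) (by omega) (by omega)
    have hneg : ((n - 1 : ℕ) : ZMod n) = -1 := by
      rw [Nat.cast_sub (by omega)]
      simp
    rw [hφ, hneg] at h
    intro x
    rw [hφ, hneg]
    push_cast at h
    linear_combination -h
end

section
/- Let Γ be a finite cyclic group acting freely on a finite set X, let Y be a set, and let c : X → Y with Aut(c) ≠ {1}. If there exist α : X → Y and γ ∈ Γ such that α ⊥ c and γ·α ⊥ c, then γ ∈ Aut(c). -/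
/-- If a sequence takes the value `f 0` after each jump, then it is constant. -/
theorem eq_zero_value_of_jump_eq {Y : Type*} (f : ℕ → Y)
    (hjump : ∀ k, f (k + 1) ≠ f k → f (k + 1) = f 0) (k : ℕ) : f k = f 0 := by
  induction k with
  | zero => rfl
  | succ k ih =>
    by_contra h
    exact h (hjump k fun e => h (e.trans ih))


/-- If `Aut(c) ≠ 1` and there exist `α ⊥ c` and `γ ∈ Γ` with `γ·α ⊥ c`,
then `γ ∈ Aut(c)`. -/
theorem stmt_12 {Γ X Y : Type*} [Group Γ] [Fintype Γ] [IsCyclic Γ]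
    [MulAction Γ X] [Fintype X]
    (hfree : ∀ (g : Γ) (x : X), g • x = x → g = 1)
    (c : X → Y)
    (hAut : ∃ δ : Γ, δ ≠ 1 ∧ ∀ x : X, c (δ⁻¹ • x) = c x)
    (α : X → Y) (γ : Γ)
    (hα : ∃! x : X, α x ≠ c x)
    (hγα : ∃! x : X, α (γ⁻¹ • x) ≠ c x) :
    ∀ x : X, c (γ⁻¹ • x) = c x := by
  obtain ⟨δ, hδ, hcδ⟩ := hAut
  obtain ⟨x₀, -, hx₀⟩ := hα
  obtain ⟨x₁, -, hx₁⟩ := hγα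
  have hD : ∀ y, c (γ⁻¹ • y) ≠ c y → y = γ • x₀ ∨ y = x₁ := by
    intro y hy
    by_contra! h
    have h₀ : α (γ⁻¹ • y) = c (γ⁻¹ • y) := by
      by_contra e
      exact h.1 (inv_smul_eq_iff.mp (hx₀ _ e))
    have h₁ : α (γ⁻¹ • y) = c y := by
      by_contra e
      exact h.2 (hx₁ _ e)
    exact hy (h₀.symm.trans h₁)
  intro q
  by_contra hq
  have hne : δ⁻¹ • q ≠ q := fun e => hδ (inv_eq_one.mp (hfree _ _ e))
  have hcomm : γ⁻¹ • δ⁻¹ • q = δ⁻¹ • γ⁻¹ • q := by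
    let _ : CommGroup Γ := IsCyclic.commGroup
    exact smul_comm _ _ _
  have hδq : c (γ⁻¹ • δ⁻¹ • q) ≠ c (δ⁻¹ • q) := by
    rwa [hcomm, hcδ, hcδ]
  have hD' : ∀ y, c (γ⁻¹ • y) ≠ c y → c y = c q := by
    intro y hy
    have : y = q ∨ y = δ⁻¹ • q := by
      have h₁ := hD y hy
      have h₂ := hD q hq
      have h₃ := hD _ hδq
      grind
    rcases this with rfl | rfl
    · rfl
    · exact hcδ q
  have hconst := eq_zero_value_of_jump_eq (fun k : ℕ => c (γ ^ k • q)) (by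
    intro k hk
    have e : γ⁻¹ • γ ^ (k + 1) • q = γ ^ k • q := by
      rw [pow_succ', mul_smul, inv_smul_smul]
    simpa using hD' (γ ^ (k + 1) • q) (by rw [e]; exact hk.symm)) (orderOf γ - 1)
  have e : γ ^ (orderOf γ - 1) = γ⁻¹ := by
    rw [eq_inv_iff_mul_eq_one, ← pow_succ, Nat.sub_add_cancel (orderOf_pos γ), pow_orderOf_eq_one]
  simp only [e, pow_zero, one_smul] at hconst
  exact hq hconst
end

section
/- Let Γ be a finite cyclic group acting freely on a finite set X, let Y be a set, and let c : X → Y. Suppose α₁, α₂, β : X → Y satisfy α₁ ⊥ c, α₂ ⊥ c, β ⊥ c, and β = γ₁·α₁ = γ₂·α₂ for some γ₁, γ₂ ∈ Γ with γ₁ ∉ Aut(c) and γ₂ ∉ Aut(c). Then α₁ = α₂. -/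
/-- If `u` is preserved by the action of `g` away from two points, then the defects of invariance
at these two points cancel. -/
lemma sub_add_sub_eq_zero_of_smul_eq {Γ X : Type*} [Group Γ] [MulAction Γ X] [Fintype X]
    (g : Γ) (u : X → ℤ) {p q : X} (hpq : p ≠ q)
    (hu : ∀ x, x ≠ p → x ≠ q → u (g • x) = u x) :
    (u (g • p) - u p) + (u (g • q) - u q) = 0 := by
  classical
  have hsum : ∑ x, (u (g • x) - u x) = 0 := by
    rw [Finset.sum_sub_distrib, sub_eq_zero]
    exact Equiv.sum_comp (MulAction.toPerm g) u
  rwa [Fintype.sum_eq_add p q hpq fun x hx => sub_eq_zero.2 (hu x hx.1 hx.2)] at hsum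

/-- A function on a finite set which is preserved by the action of `g` away from one point is
preserved by the action of `g`. -/
lemma smul_eq_of_forall_ne_smul_eq {Γ X Y : Type*} [Group Γ] [MulAction Γ X] [Fintype X]
    (g : Γ) (c : X → Y) (p : X) (hc : ∀ x, x ≠ p → c (g • x) = c x) (x : X) :
    c (g • x) = c x := by
  classical
  by_cases hx : x = p
  · subst hx
    have hsum : ∑ y, ((if c (g • y) = c x then (1 : ℤ) else 0) - if c y = c x then 1 else 0) = 0 := by
      rw [Finset.sum_sub_distrib, sub_eq_zero]
      exact Equiv.sum_comp (MulAction.toPerm g) fun y => if c y = c x then (1 : ℤ) else 0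
    rw [Fintype.sum_eq_single x fun y hy => by rw [hc y hy, sub_self]] at hsum
    by_contra hne
    simp [hne] at hsum
  · exact hc x hx

open Classical in
/-- Suppose `α` and `β = γ • α` differ from `c` exactly at `p` and `z` respectively, and `γ` does
not stabilize `c`. Then `α p = β z`, and the indicator of the fibre of `c` through `z` changes
under `γ` exactly at `γ⁻¹ • z` and `p`. -/
lemma eq_and_indicator_sub_of_not_stabilizer {Γ X Y : Type*} [Group Γ] [MulAction Γ X] [Fintype X]
    {c α β : X → Y} {γ : Γ} {p z : X}
    (hp : α p ≠ c p) (hp' : ∀ x, x ≠ p → α x = c x)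
    (hz : β z ≠ c z) (hz' : ∀ x, x ≠ z → β x = c x)
    (hb : ∀ x, β (γ • x) = α x) (hg : ¬ ∀ x, c (γ • x) = c x) :
    γ • p ≠ z ∧ α p = β z ∧
      ∀ x, (if c (γ • x) = c z then (1 : ℤ) else 0) - (if c x = c z then 1 else 0) =
        (if γ • x = z then 1 else 0) - (if x = p then 1 else 0) := by
  have hinv : ∀ x, γ • x ≠ z → x ≠ p → c (γ • x) = c x := fun x h h' => by
    rw [← hz' _ h, hb, hp' x h']
  have hpz : γ • p ≠ z := by
    intro h
    refine hg (smul_eq_of_forall_ne_smul_eq γ c p fun x hx => hinv x ?_ hx)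
    rw [← h]
    exact fun h' => hx (MulAction.injective γ h')
  obtain ⟨q, rfl⟩ := MulAction.surjective γ z
  have hqp : q ≠ p := fun h => hpz (h ▸ rfl)
  have hcq : β (γ • q) = c q := by rw [hb, hp' q hqp]
  have hcp : α p = c (γ • p) := by rw [← hb, hz' _ hpz]
  have hdef : ∀ y : Y, _ := fun y => sub_add_sub_eq_zero_of_smul_eq γ
    (fun x => if c x = y then (1 : ℤ) else 0) hqp fun x h h' => by
      simp only [hinv x (fun e => h (MulAction.injective γ e)) h']
  rw [hcq] at hz
  refine ⟨hpz, ?_, fun x => ?_⟩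
  · have h := hdef (c q)
    rw [hcq, hcp]
    by_contra hne
    simp only [hz.symm, hne, if_true, if_false] at h
    split_ifs at h <;> omega
  · have h := hdef (c (γ • q))
    simp only [hz, if_true, if_false] at h
    by_cases hxq : x = q
    · subst hxq
      simp [hz, hqp]
    by_cases hxp : x = p
    · subst hxp
      simp only [hpz, if_true, if_false]
      linarith
    · have hx : γ • x ≠ γ • q := fun e => hxq (MulAction.injective γ e)
      simp [hinv x hx hxp, hxq, hxp]

/-- If `α₁, α₂, β ⊥ c` and `β = γ₁·α₁ = γ₂·α₂` with `γ₁, γ₂ ∉ Aut(c)`,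
then `α₁ = α₂`. -/
theorem stmt_13 {Γ X Y : Type*} [Group Γ] [Fintype Γ] [IsCyclic Γ]
    [MulAction Γ X] [Fintype X]
    (hfree : ∀ (g : Γ) (x : X), g • x = x → g = 1)
    (c α₁ α₂ β : X → Y) (γ₁ γ₂ : Γ)
    (h1 : ∃! x : X, α₁ x ≠ c x) (h2 : ∃! x : X, α₂ x ≠ c x)
    (h3 : ∃! x : X, β x ≠ c x)
    (hb1 : ∀ x : X, β x = α₁ (γ₁⁻¹ • x)) (hb2 : ∀ x : X, β x = α₂ (γ₂⁻¹ • x))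
    (hg1 : ¬ ∀ x : X, c (γ₁⁻¹ • x) = c x) (hg2 : ¬ ∀ x : X, c (γ₂⁻¹ • x) = c x) :
    α₁ = α₂ := by
  classical
  obtain ⟨p₁, hp₁, hu₁⟩ := h1
  obtain ⟨p₂, hp₂, hu₂⟩ := h2
  obtain ⟨z, hz, hu⟩ := h3
  have hp₁' : ∀ x, x ≠ p₁ → α₁ x = c x := fun x hx => by_contra fun h => hx (hu₁ x h)
  have hp₂' : ∀ x, x ≠ p₂ → α₂ x = c x := fun x hx => by_contra fun h => hx (hu₂ x h)
  have hz' : ∀ x, x ≠ z → β x = c x := fun x hx => by_contra fun h => hx (hu x h)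
  have hstab : ∀ g : Γ, (¬ ∀ x, c (g⁻¹ • x) = c x) → ¬ ∀ x, c (g • x) = c x := fun g hg h =>
    hg fun x => by rw [← h (g⁻¹ • x), smul_inv_smul]
  obtain ⟨hpz, e₁, D₁⟩ := eq_and_indicator_sub_of_not_stabilizer hp₁ hp₁' hz hz'
    (fun x => by rw [hb1, inv_smul_smul]) (hstab γ₁ hg1)
  obtain ⟨-, e₂, D₂⟩ := eq_and_indicator_sub_of_not_stabilizer hp₂ hp₂' hz hz'
    (fun x => by rw [hb2, inv_smul_smul]) (hstab γ₂ hg2)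
  have hne : γ₂ • p₁ ≠ p₁ := fun h => hg2 fun x => by simp [hfree γ₂ p₁ h]
  have hcomm : γ₂ • γ₁ • p₁ = γ₁ • γ₂ • p₁ := by
    rw [smul_smul, smul_smul, IsCyclic.isMulCommutative.is_comm.comm γ₂ γ₁]
  have hp : p₁ = p₂ := by
    by_contra hp
    have a := D₁ (γ₂ • p₁)
    have b := D₁ p₁
    have d := D₂ (γ₁ • p₁)
    have e := D₂ p₁
    rw [hcomm] at d
    simp only [hne, hp, hpz, if_true, if_false] at a b d e
    split_ifs at a b d e <;> omega
  subst hp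
  funext x
  by_cases hx : x = p₁
  · rw [hx, e₁, e₂]
  · rw [hp₁' x hx, hp₂' x hx]
end

section
/- Let Γ be a finite cyclic group acting freely on a finite set X, let Y be a totally ordered set, and let c : X → Y. If α₁, α₂ : X → Y satisfy α₁ < c and α₂ < c, and the stabilizers Aut(α₁) and Aut(α₂) are both nontrivial, then α₁ = α₂. -/
/-- A finite cyclic group has at most one involution. -/
theorem IsCyclic.eq_of_mul_self_eq_one {Γ : Type*} [Group Γ] [Fintype Γ] [IsCyclic Γ] {g h : Γ}
    (hg : g ≠ 1) (hh : h ≠ 1) (hg2 : g * g = 1) (hh2 : h * h = 1) : g = h := by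
  classical
  by_contra hne
  have hle := IsCyclic.card_pow_eq_one_le (α := Γ) (n := 2) two_pos
  have hsub : ({1, g, h} : Finset Γ) ⊆ Finset.univ.filter (fun a : Γ => a ^ 2 = 1) := by
    intro a ha
    simp only [Finset.mem_insert, Finset.mem_singleton] at ha
    rcases ha with rfl | rfl | rfl <;> simp [pow_two, *]
  have hcard : ({1, g, h} : Finset Γ).card = 3 :=
    Finset.card_eq_three.mpr ⟨1, g, h, hg.symm, hh.symm, hne, rfl⟩
  have := Finset.card_le_card hsub
  omega

/-- If `a` is `g`-invariant, `b` is `h`-invariant, `b < a` at `x₂`, and `a ≤ b` away from `x₂` while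
`b ≤ a` away from `x₁`, then `g * h` moves `x₂` to `x₁`. -/
theorem mul_smul_eq_of_invariant {Γ X Y : Type*} [Group Γ] [MulAction Γ X] [LinearOrder Y]
    {a b : X → Y} {g h : Γ} {x₁ x₂ : X} (hcomm : g * h = h * g)
    (ha : ∀ x, a (g • x) = a x) (hb : ∀ x, b (h • x) = b x)
    (hgx : g • x₂ ≠ x₂) (hhx : h • x₂ ≠ x₂)
    (hab : ∀ x, x ≠ x₂ → a x ≤ b x) (hba : ∀ x, x ≠ x₁ → b x ≤ a x) (hlt : b x₂ < a x₂) :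
    (g * h) • x₂ = x₁ := by
  by_contra hne
  refine lt_irrefl (a x₂) ?_
  calc a x₂ = a (g • x₂) := (ha _).symm
    _ ≤ b (g • x₂) := hab _ hgx
    _ = b ((g * h) • x₂) := by rw [hcomm, mul_smul, hb]
    _ ≤ a ((g * h) • x₂) := hba _ hne
    _ = a (h • x₂) := by rw [mul_smul, ha]
    _ ≤ b (h • x₂) := hab _ hhx
    _ = b x₂ := hb _
    _ < a x₂ := hlt

/-- If `a` is `g`-invariant, `b` is `h`-invariant, and they agree away from a point moved by both
`g` and `h`, then they also agree at that point. -/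
theorem apply_eq_of_invariant {Γ X Y : Type*} [Group Γ] [MulAction Γ X]
    {a b : X → Y} {g h : Γ} {x₀ : X} (hcomm : g * h = h * g)
    (ha : ∀ x, a (g • x) = a x) (hb : ∀ x, b (h • x) = b x)
    (hgx : g • x₀ ≠ x₀) (hhx : h • x₀ ≠ x₀)
    (hab : ∀ x, x ≠ x₀ → a x = b x) : a x₀ = b x₀ := by
  have h1 : a x₀ = b ((g * h) • x₀) := by rw [hcomm, mul_smul, hb, ← hab _ hgx, ha]
  have h2 : b x₀ = a ((g * h) • x₀) := by rw [mul_smul, ha, hab _ hhx, hb]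
  by_cases hx : (g * h) • x₀ = x₀
  · rw [h1, hx]
  · rw [h1, h2, hab _ hx]

/-- At most one child of a necklace admits symmetries: if `α₁ < c` and `α₂ < c`
with `Aut(α₁) ≠ 1` and `Aut(α₂) ≠ 1`, then `α₁ = α₂`. -/
theorem stmt_14 {Γ X Y : Type*} [Group Γ] [Fintype Γ] [IsCyclic Γ]
    [MulAction Γ X] [Fintype X] [LinearOrder Y]
    (hfree : ∀ (g : Γ) (x : X), g • x = x → g = 1)
    (c α₁ α₂ : X → Y)
    (hc1 : (∃! x : X, α₁ x ≠ c x) ∧ ∀ x : X, α₁ x ≤ c x)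
    (hc2 : (∃! x : X, α₂ x ≠ c x) ∧ ∀ x : X, α₂ x ≤ c x)
    (hA1 : ∃ g : Γ, g ≠ 1 ∧ ∀ x : X, α₁ (g⁻¹ • x) = α₁ x)
    (hA2 : ∃ g : Γ, g ≠ 1 ∧ ∀ x : X, α₂ (g⁻¹ • x) = α₂ x) :
    α₁ = α₂ := by
  obtain ⟨⟨x₁, hx₁, hu₁⟩, hle₁⟩ := hc1
  obtain ⟨⟨x₂, hx₂, hu₂⟩, hle₂⟩ := hc2
  obtain ⟨g, hg, hgα⟩ := hA1
  obtain ⟨h, hh, hhα⟩ := hA2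
  have hcomm : ∀ a b : Γ, a * b = b * a := (IsCyclic.isMulCommutative (α := Γ)).is_comm.comm
  have e₁ : ∀ x, x ≠ x₁ → α₁ x = c x := fun x hx => by_contra fun hn => hx (hu₁ x hn)
  have e₂ : ∀ x, x ≠ x₂ → α₂ x = c x := fun x hx => by_contra fun hn => hx (hu₂ x hn)
  have hgα' : ∀ x, α₁ (g • x) = α₁ x := fun x => by rw [← hgα (g • x), inv_smul_smul]
  have hhα' : ∀ x, α₂ (h • x) = α₂ x := fun x => by rw [← hhα (h • x), inv_smul_smul]
  have move : ∀ {k : Γ} (x : X), k ≠ 1 → k • x ≠ x := fun x hk hx => hk (hfree _ x hx)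
  by_cases hne : x₁ = x₂
  · subst hne
    have agree : ∀ x, x ≠ x₁ → α₁ x = α₂ x := fun x hx => (e₁ x hx).trans (e₂ x hx).symm
    funext x
    by_cases hx : x = x₁
    · rw [hx]
      exact apply_eq_of_invariant (hcomm g h) hgα' hhα' (move _ hg) (move _ hh) agree
    · exact agree x hx
  · exfalso
    have hab : ∀ x, x ≠ x₂ → α₁ x ≤ α₂ x := fun x hx => (hle₁ x).trans_eq (e₂ x hx).symm
    have hba : ∀ x, x ≠ x₁ → α₂ x ≤ α₁ x := fun x hx => (hle₂ x).trans_eq (e₁ x hx).symm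
    have hlt : α₂ x₂ < α₁ x₂ := by
      rw [e₁ x₂ (Ne.symm hne)]
      exact lt_of_le_of_ne (hle₂ x₂) hx₂
    have hg' : g⁻¹ ≠ 1 := inv_ne_one.mpr hg
    have hh' : h⁻¹ ≠ 1 := inv_ne_one.mpr hh
    have k₁ := mul_smul_eq_of_invariant (hcomm _ _) hgα' hhα' (move _ hg) (move _ hh) hab hba hlt
    have k₂ := mul_smul_eq_of_invariant (hcomm _ _) hgα' hhα (move _ hg) (move _ hh') hab hba hlt
    have k₃ := mul_smul_eq_of_invariant (hcomm _ _) hgα hhα' (move _ hg') (move _ hh) hab hba hlt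
    have inj : ∀ {a b : Γ}, a • x₂ = b • x₂ → a = b := fun {a b} hab => by
      refine (inv_mul_eq_one.mp (hfree (b⁻¹ * a) x₂ ?_)).symm
      rw [mul_smul, hab, inv_smul_smul]
    have hh2 : h * h = 1 :=
      mul_eq_one_iff_eq_inv.mpr (mul_left_cancel (inj (k₁.trans k₂.symm)))
    have hg2 : g * g = 1 :=
      mul_eq_one_iff_eq_inv.mpr (mul_right_cancel (inj (k₁.trans k₃.symm)))
    obtain rfl := IsCyclic.eq_of_mul_self_eq_one hg hh hg2 hh2
    rw [hg2, one_smul] at k₁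
    exact hne k₁.symm
end

section
/- Let Γ be a finite commutative group with at most one subgroup of order 2, acting freely on a finite set X, let Y be a totally ordered set, and let c : X → Y. If α₁, α₂ : X → Y satisfy α₁ < c and α₂ < c, and the stabilizers Aut(α₁) and Aut(α₂) are both nontrivial, then α₁ = α₂. -/
/-- If `f` and `f'` agree off `{x, y}`, with opposite strict inequalities at `x` and `y`, and `f` is
`g`-invariant, then `f'` cannot take the same value at `x` and `g • x`. -/
theorem smul_ne_of_opposite_defects {Γ X Y : Type*} [SMul Γ X] [LinearOrder Y]
    {f f' : X → Y} {x y : X} {g : Γ} (hoff : ∀ z, z ≠ x → z ≠ y → f z = f' z)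
    (hx : f x < f' x) (hy : f' y < f y) (hgx : g • x ≠ x) (hg : ∀ z, f (g • z) = f z) :
    f' (g • x) ≠ f' x := by
  intro h
  have hlt : f (g • x) < f' (g • x) := by rw [hg, h]; exact hx
  by_cases hgy : g • x = y
  · rw [hgy] at hlt
    exact lt_asymm hlt hy
  · exact hlt.ne (hoff _ hgx hgy)

theorem eq_of_smul_eq_smul_of_free {Γ X : Type*} [Group Γ] [MulAction Γ X]
    (hfree : ∀ (g : Γ) (x : X), g • x = x → g = 1) {a b : Γ} {x : X} (h : a • x = b • x) :
    a = b := by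
  have h' : (b⁻¹ * a) • x = x := by rw [mul_smul, h, inv_smul_smul]
  exact (inv_mul_eq_one.mp (hfree _ _ h')).symm

/-- If `f` and `f'` agree off `{x, y}`, with opposite strict inequalities at `x` and `y`, then every
symmetry of `f'` is an involution as soon as `f` has a nontrivial symmetry. -/
theorem mul_self_eq_one_of_opposite_defects {Γ X Y : Type*} [CommGroup Γ] [MulAction Γ X]
    [LinearOrder Y] (hfree : ∀ (g : Γ) (x : X), g • x = x → g = 1)
    {f f' : X → Y} {x y : X} {g h : Γ} (hoff : ∀ z, z ≠ x → z ≠ y → f z = f' z)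
    (hx : f x < f' x) (hy : f' y < f y) (hg1 : g ≠ 1)
    (hg : ∀ z, f (g • z) = f z) (hh : ∀ z, f' (h • z) = f' z) : h * h = 1 := by
  by_contra hhh
  have hne := smul_ne_of_opposite_defects hoff hx hy (fun e => hg1 (hfree _ _ e)) hg
  have hh1 : h ≠ 1 := by rintro rfl; simp at hhh
  have hh2 : ∀ z, f' ((h * h) • z) = f' z := fun z => by rw [mul_smul, hh, hh]
  have not_inv : ∀ u : Γ, (∀ z, f' (u • z) = f' z) → u * g ≠ 1 := by
    intro u hu e
    apply hne
    rw [← hu (g • x), smul_smul, e, one_smul]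
  have meets : ∀ u : Γ, u ≠ 1 → (∀ z, f' (u • z) = f' z) → u • x = y ∨ (u * g) • x = y := by
    intro u hu1 hu
    by_contra! hcon
    apply hne
    have h1 := hoff (u • x) (fun e => hu1 (hfree _ _ e)) hcon.1
    have h2 := hoff ((u * g) • x) (fun e => not_inv u hu (hfree _ _ e)) hcon.2
    rw [← hu (g • x), ← hu x, smul_smul, ← h1, ← h2, mul_comm, mul_smul, hg]
  have hgh : g ≠ h := by rintro rfl; exact hne (hh x)
  rcases meets h hh1 hh with e1 | e1 <;> rcases meets (h * h) hhh hh2 with e2 | e2 <;>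
    have e := eq_of_smul_eq_smul_of_free hfree (e1.trans e2.symm)
  · exact hh1 (by simpa using e)
  · exact not_inv h hh (by simpa [mul_assoc] using e)
  · exact hgh (mul_left_cancel e)
  · exact hh1 (by simpa using mul_right_cancel e)

/-- Two functions differing at most at one point and each having a nontrivial symmetry are equal
at that point. -/
theorem apply_eq_of_eq_off_point {Γ X Y : Type*} [CommGroup Γ] [MulAction Γ X]
    (hfree : ∀ (g : Γ) (x : X), g • x = x → g = 1)
    {f f' : X → Y} {x : X} {g h : Γ} (hoff : ∀ z, z ≠ x → f z = f' z)
    (hg1 : g ≠ 1) (hh1 : h ≠ 1)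
    (hg : ∀ z, f (g • z) = f z) (hh : ∀ z, f' (h • z) = f' z) : f x = f' x := by
  have hgx := hoff (g • x) fun e => hg1 (hfree _ _ e)
  have hhx := hoff (h • x) fun e => hh1 (hfree _ _ e)
  by_cases hgh : g * h = 1
  · rw [← hg x, hgx, ← hh (g • x), smul_smul, mul_comm, hgh, one_smul]
  · have hghx := hoff ((g * h) • x) fun e => hgh (hfree _ _ e)
    calc f x = f' ((h * g) • x) := by rw [mul_smul, hh, ← hgx, hg]
      _ = f ((g * h) • x) := by rw [hghx, mul_comm]
      _ = f' x := by rw [mul_smul, hg, hhx, hh]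

theorem eq_of_mul_self_eq_one {Γ : Type*} [Group Γ]
    (h2 : ∀ H K : Subgroup Γ, Nat.card H = 2 → Nat.card K = 2 → H = K)
    {g h : Γ} (hg1 : g ≠ 1) (hh1 : h ≠ 1) (hg : g * g = 1) (hh : h * h = 1) : g = h := by
  have card_two : ∀ k : Γ, k ≠ 1 → k * k = 1 → Nat.card (Subgroup.zpowers k) = 2 := by
    intro k hk1 hk
    rw [Nat.card_zpowers]
    exact orderOf_eq_prime (by rw [pow_two, hk]) hk1
  have hmem : g ∈ Subgroup.zpowers h := by
    rw [← h2 _ _ (card_two g hg1 hg) (card_two h hh1 hh)]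
    exact Subgroup.mem_zpowers g
  obtain ⟨n, rfl⟩ := Subgroup.mem_zpowers_iff.mp hmem
  have hsq : h ^ (2 : ℤ) = 1 := by rw [zpow_two, hh]
  rcases Int.even_or_odd' n with ⟨k, rfl | rfl⟩
  · exact absurd (by rw [zpow_mul, hsq, one_zpow]) hg1
  · rw [zpow_add, zpow_mul, hsq, one_zpow, one_mul, zpow_one]


/-- At most one child of a necklace admits symmetries, for `Γ` a finite
commutative group with at most one subgroup of order 2. -/
theorem stmt_15 {Γ X Y : Type*} [CommGroup Γ] [Fintype Γ]
    [MulAction Γ X] [Fintype X] [LinearOrder Y]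
    (h2 : ∀ H K : Subgroup Γ, Nat.card H = 2 → Nat.card K = 2 → H = K)
    (hfree : ∀ (g : Γ) (x : X), g • x = x → g = 1)
    (c α₁ α₂ : X → Y)
    (hc1 : (∃! x : X, α₁ x ≠ c x) ∧ ∀ x : X, α₁ x ≤ c x)
    (hc2 : (∃! x : X, α₂ x ≠ c x) ∧ ∀ x : X, α₂ x ≤ c x)
    (hA1 : ∃ g : Γ, g ≠ 1 ∧ ∀ x : X, α₁ (g⁻¹ • x) = α₁ x)
    (hA2 : ∃ g : Γ, g ≠ 1 ∧ ∀ x : X, α₂ (g⁻¹ • x) = α₂ x) :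
    α₁ = α₂ := by
  obtain ⟨⟨x, hx, hxu⟩, hle1⟩ := hc1
  obtain ⟨⟨y, hy, hyu⟩, hle2⟩ := hc2
  obtain ⟨g, hg1, hg⟩ := hA1
  obtain ⟨h, hh1, hh⟩ := hA2
  have hg1' : g⁻¹ ≠ 1 := inv_ne_one.mpr hg1
  have hh1' : h⁻¹ ≠ 1 := inv_ne_one.mpr hh1
  have off1 : ∀ z, z ≠ x → α₁ z = c z := fun z hz => by_contra fun e => hz (hxu z e)
  have off2 : ∀ z, z ≠ y → α₂ z = c z := fun z hz => by_contra fun e => hz (hyu z e)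
  by_cases hxy : x = y
  · subst hxy
    have hoff : ∀ z, z ≠ x → α₁ z = α₂ z := fun z hz => (off1 z hz).trans (off2 z hz).symm
    funext z
    by_cases hz : z = x
    · rw [hz]
      exact apply_eq_of_eq_off_point hfree hoff hg1' hh1' hg hh
    · exact hoff z hz
  · exfalso
    have hoff : ∀ z, z ≠ x → z ≠ y → α₁ z = α₂ z :=
      fun z hzx hzy => (off1 z hzx).trans (off2 z hzy).symm
    have hltx : α₁ x < α₂ x := by
      rw [off2 x hxy]
      exact lt_of_le_of_ne (hle1 x) hx
    have hlty : α₂ y < α₁ y := by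
      rw [off1 y (Ne.symm hxy)]
      exact lt_of_le_of_ne (hle2 y) hy
    have hhsq := mul_self_eq_one_of_opposite_defects hfree hoff hltx hlty hg1' hg hh
    have hgsq := mul_self_eq_one_of_opposite_defects hfree
      (fun z hzy hzx => (hoff z hzx hzy).symm) hlty hltx hh1' hh hg
    have hgh := eq_of_mul_self_eq_one h2 hg1' hh1' hgsq hhsq
    refine smul_ne_of_opposite_defects hoff hltx hlty (fun e => hg1' (hfree _ _ e)) hg ?_
    rw [hgh, hh]
end

section
/- Let Γ be a finite cyclic group acting freely on a finite set X, let Y be a totally ordered set, and let c : X → Y. Suppose α₁, β₁, α₂, β₂ : X → Y are four pairwise distinct children of c (αᵢ < c and βᵢ < c) with β₁ = γ₁·α₁ and β₂ = γ₂·α₂, where γ₁, γ₂ ∈ Γ satisfy ⟨γ₂⟩ ⊆ ⟨γ₁⟩, γ₁ ∉ Aut(c) and γ₂ ∉ Aut(c). Then there exists a unique ⟨γ₁⟩-orbit 𝒪 in X such that the number of x ∈ 𝒪 with c(x) = max c(𝒪) equals |𝒪| − 1; moreover c is constant on every ⟨γ₁⟩-orbit P ≠ 𝒪. -/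
open MulAction in
/-- In a finite group, a predicate stable under `γ` is stable under the subgroup it generates. -/
theorem forall_mem_orbit_zpowers_of_smul {Γ X : Type*} [Group Γ] [Finite Γ] [MulAction Γ X]
    {γ : Γ} {p : X → Prop} (hp : ∀ x, p x → p (γ • x)) {x y : X} (hx : p x)
    (hy : y ∈ orbit (Subgroup.zpowers γ) x) : p y := by
  obtain ⟨⟨g, hg⟩, rfl⟩ := hy
  obtain ⟨n, rfl⟩ := (mem_powers_iff_mem_zpowers (x := γ)).2 hg
  change p (γ ^ n • x)
  clear hg
  induction n with
  | zero => simpa using hx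
  | succ n ih => rw [pow_succ', mul_smul]; exact hp _ ih

theorem smul_mem_orbit_zpowers {Γ X : Type*} [Group Γ] [MulAction Γ X]
    {γ g : Γ} (hg : g ∈ Subgroup.zpowers γ) {x y : X}
    (hy : y ∈ MulAction.orbit (Subgroup.zpowers γ) x) :
    g • y ∈ MulAction.orbit (Subgroup.zpowers γ) x :=
  MulAction.mapsTo_smul_orbit (⟨g, hg⟩ : Subgroup.zpowers γ) x hy

open MulAction in
/-- If `α` and `γ • α` are children of `c` and `γ` does not fix `c`, then `α` and `γ • α` lower `c`
at points `a` and `b` respectively, and along `γ` the map `c` drops exactly at `a` and rises exactly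
when arriving at `b`. -/
theorem exists_drop_rise_of_twins {Γ X Y : Type*} [Group Γ] [Finite Γ] [MulAction Γ X]
    [LinearOrder Y] {c α β : X → Y} {γ : Γ}
    (hα : (∃! x : X, α x ≠ c x) ∧ ∀ x : X, α x ≤ c x)
    (hβ : (∃! x : X, β x ≠ c x) ∧ ∀ x : X, β x ≤ c x)
    (h : ∀ x : X, β x = α (γ⁻¹ • x)) (hγ : ¬ ∀ x : X, c (γ⁻¹ • x) = c x) :
    ∃ a b : X, (∀ x, x ≠ a → α x = c x) ∧ (∀ x, x ≠ b → β x = c x) ∧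
      α a = c (γ • a) ∧ β b = c (γ⁻¹ • b) ∧ c (γ • a) < c a ∧ c (γ⁻¹ • b) < c b ∧
      ∀ x, x ≠ a → γ • x ≠ b → c (γ • x) = c x := by
  obtain ⟨⟨a, ha, ha'⟩, hαc⟩ := hα
  obtain ⟨⟨b, hb, hb'⟩, hβc⟩ := hβ
  have hαx : ∀ x, x ≠ a → α x = c x := fun x hx => by_contra fun h => hx (ha' x h)
  have hβx : ∀ x, x ≠ b → β x = c x := fun x hx => by_contra fun h => hx (hb' x h)
  have hstep : ∀ x, x ≠ a → γ • x ≠ b → c (γ • x) = c x := fun x hx hx' => by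
    rw [← hβx _ hx', h, inv_smul_smul, hαx x hx]
  have hne : γ • a ≠ b := by
    intro hab
    have hconst : ∀ x, x ≠ a → c (γ • x) = c x := fun x hx =>
      hstep x hx fun hxb => hx (smul_left_cancel γ (hxb.trans hab.symm))
    refine hγ fun x => ?_
    obtain ⟨y, rfl⟩ := MulAction.surjective γ x
    rw [inv_smul_smul]
    by_cases hy : y = a
    · subst hy
      by_contra hca
      refine hca (forall_mem_orbit_zpowers_of_smul (γ := γ) (p := fun x => c x = c (γ • y))
        (x := γ • y) (fun x hx => ?_) rfl ?_)
      · rw [hconst x (by rintro rfl; exact hca hx), hx]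
      · simpa using smul_mem_orbit_zpowers (inv_mem (Subgroup.mem_zpowers γ))
          (mem_orbit_self (M := Subgroup.zpowers γ) (γ • y))
    · exact (hconst y hy).symm
  have hαa : α a = c (γ • a) := by rw [← hβx _ hne, h, inv_smul_smul]
  have hβb : β b = c (γ⁻¹ • b) := by
    rw [h, hαx]
    rintro hab
    exact hne (by rw [← hab, smul_inv_smul])
  exact ⟨a, b, hαx, hβx, hαa, hβb, hαa ▸ lt_of_le_of_ne (hαc a) ha,
    hβb ▸ lt_of_le_of_ne (hβc b) hb, hstep⟩


/-- Twins lemma: if `α₁, β₁, α₂, β₂` are four pairwise distinct children of `c`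
with `β₁ = γ₁·α₁`, `β₂ = γ₂·α₂`, `⟨γ₂⟩ ⊆ ⟨γ₁⟩` and `γ₁, γ₂ ∉ Aut(c)`, then there
is a unique `⟨γ₁⟩`-orbit `𝒪` with `|c⁻¹(max c(𝒪)) ∩ 𝒪| = |𝒪| - 1`, and `c` is
constant on every other `⟨γ₁⟩`-orbit. -/
theorem stmt_16 {Γ X Y : Type*} [Group Γ] [Fintype Γ] [IsCyclic Γ]
    [MulAction Γ X] [Fintype X] [LinearOrder Y]
    (hfree : ∀ (g : Γ) (x : X), g • x = x → g = 1)
    (c α₁ β₁ α₂ β₂ : X → Y) (γ₁ γ₂ : Γ)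
    (hdist : α₁ ≠ β₁ ∧ α₁ ≠ α₂ ∧ α₁ ≠ β₂ ∧ β₁ ≠ α₂ ∧ β₁ ≠ β₂ ∧ α₂ ≠ β₂)
    (hc1 : (∃! x : X, α₁ x ≠ c x) ∧ ∀ x : X, α₁ x ≤ c x)
    (hc2 : (∃! x : X, β₁ x ≠ c x) ∧ ∀ x : X, β₁ x ≤ c x)
    (hc3 : (∃! x : X, α₂ x ≠ c x) ∧ ∀ x : X, α₂ x ≤ c x)
    (hc4 : (∃! x : X, β₂ x ≠ c x) ∧ ∀ x : X, β₂ x ≤ c x)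
    (hb1 : ∀ x : X, β₁ x = α₁ (γ₁⁻¹ • x)) (hb2 : ∀ x : X, β₂ x = α₂ (γ₂⁻¹ • x))
    (hsub : Subgroup.zpowers γ₂ ≤ Subgroup.zpowers γ₁)
    (hg1 : ¬ ∀ x : X, c (γ₁⁻¹ • x) = c x) (hg2 : ¬ ∀ x : X, c (γ₂⁻¹ • x) = c x) :
    ∃ O : Set X, (∃ x : X, O = MulAction.orbit (Subgroup.zpowers γ₁) x) ∧
      (∃ ymax : Y, IsGreatest (c '' O) ymax ∧
        {x ∈ O | c x = ymax}.ncard = O.ncard - 1) ∧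
      (∀ O' : Set X, (∃ x : X, O' = MulAction.orbit (Subgroup.zpowers γ₁) x) →
        (∃ ymax : Y, IsGreatest (c '' O') ymax ∧
          {x ∈ O' | c x = ymax}.ncard = O'.ncard - 1) → O' = O) ∧
      (∀ P : Set X, (∃ x : X, P = MulAction.orbit (Subgroup.zpowers γ₁) x) →
        P ≠ O → ∀ x ∈ P, ∀ y ∈ P, c x = c y) := by
  obtain ⟨-, h12, -, h12', -, -⟩ := hdist
  obtain ⟨a, b, hα, hβ, hαa, hβb, hdrop, hrise, hstep⟩ := exists_drop_rise_of_twins hc1 hc2 hb1 hg1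
  obtain ⟨a', b', hα', -, hαa', -, hdrop', hrise', hstep'⟩ :=
    exists_drop_rise_of_twins hc3 hc4 hb2 hg2
  have hγ := Subgroup.mem_zpowers γ₁
  have hγ' := hsub (Subgroup.mem_zpowers γ₂)
  set O := MulAction.orbit (Subgroup.zpowers γ₁) a with hO
  have haO : a ∈ O := MulAction.mem_orbit_self a
  have hlow : γ₁⁻¹ • b ∈ O ∧ c (γ₁⁻¹ • b) = c (γ₁ • a) := by
    by_contra hcon
    refine hdrop.ne' (forall_mem_orbit_zpowers_of_smul (γ := γ₁)
      (p := fun x => x ∈ O ∧ c x = c (γ₁ • a)) (x := γ₁ • a) (y := a)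
      (fun x hx => ⟨smul_mem_orbit_zpowers hγ hx.1, ?_⟩) ⟨smul_mem_orbit_zpowers hγ haO, rfl⟩ ?_).2
    · rw [hstep x (by rintro rfl; exact hdrop.ne' hx.2) (by rintro rfl; simp [hx] at hcon), hx.2]
    · simpa using smul_mem_orbit_zpowers (inv_mem hγ)
        (MulAction.mem_orbit_self (M := Subgroup.zpowers γ₁) (γ₁ • a))
  have hbO : b ∈ O := by simpa using smul_mem_orbit_zpowers hγ hlow.1
  have hhigh : c b = c a := by
    by_contra hcon
    refine hrise.ne (forall_mem_orbit_zpowers_of_smul (γ := γ₁)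
      (p := fun x => c x = c b) (x := b) (fun x hx => ?_) rfl
      (smul_mem_orbit_zpowers (inv_mem hγ) (MulAction.mem_orbit_self b)))
    by_cases hxb : γ₁ • x = b
    · rw [hxb]
    · rw [hstep x (by rintro rfl; exact hcon hx.symm) hxb, hx]
  have htwo : ∀ x ∈ O, c x = c a ∨ c x = c (γ₁ • a) := by
    intro x hx
    refine forall_mem_orbit_zpowers_of_smul (γ := γ₁)
      (p := fun x => c x = c a ∨ c x = c (γ₁ • a)) (fun x hx => ?_) (Or.inl rfl) hx
    by_cases hxa : x = a
    · exact Or.inr (by rw [hxa])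
    by_cases hxb : γ₁ • x = b
    · exact Or.inl (by rw [hxb, hhigh])
    · rwa [hstep x hxa hxb]
  have hconst : ∀ P : Set X, (∃ x : X, P = MulAction.orbit (Subgroup.zpowers γ₁) x) →
      P ≠ O → ∀ x ∈ P, ∀ y ∈ P, c x = c y := by
    rintro _ ⟨w, rfl⟩ hP x hx y hy
    rw [← MulAction.orbit_eq_iff.2 hx] at hP hy
    have hxO : x ∉ O := fun hxO => hP (MulAction.orbit_eq_iff.2 hxO)
    refine (forall_mem_orbit_zpowers_of_smul (γ := γ₁)
      (p := fun y => y ∉ O ∧ c y = c x) (fun y hy => ?_) ⟨hxO, rfl⟩ hy).2.symm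
    have hyO : γ₁ • y ∉ O := fun h =>
      hy.1 (by simpa using smul_mem_orbit_zpowers (inv_mem hγ) h)
    exact ⟨hyO, by rw [hstep y (by rintro rfl; exact hy.1 haO) (by rintro rfl; exact hyO hbO),
      hy.2]⟩
  have haO' : a' ∈ O := by
    by_contra hcon
    have hself := MulAction.mem_orbit_self (M := Subgroup.zpowers γ₁) a'
    refine hdrop'.ne (hconst _ ⟨a', rfl⟩ (fun h => hcon (h ▸ hself)) _
      (smul_mem_orbit_zpowers hγ' hself) _ hself)
  have hlt : ∀ x ∈ O, ∀ y ∈ O, c x < c y → c x = c (γ₁ • a) ∧ c y = c a := by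
    intro x hx y hy hxy
    rcases htwo x hx with h | h <;> rcases htwo y hy with h' | h' <;> rw [h, h'] at hxy
    · exact absurd hxy (lt_irrefl _)
    · exact absurd hxy hdrop.not_gt
    · exact ⟨h, h'⟩
    · exact absurd hxy (lt_irrefl _)
  obtain ⟨hlow', hhigh'⟩ := hlt _ (smul_mem_orbit_zpowers hγ' haO') _ haO' hdrop'
  have hne : a' ≠ a := by
    rintro rfl
    refine h12 (funext fun x => ?_)
    by_cases hx : x = a'
    · rw [hx, hαa, hαa', hlow']
    · rw [hα x hx, hα' x hx]
  have hne' : a' ≠ b := by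
    rintro rfl
    refine h12' (funext fun x => ?_)
    by_cases hx : x = a'
    · rw [hx, hβb, hαa', hlow', hlow.2]
    · rw [hβ x hx, hα' x hx]
  have hle' : ∀ x, x ≠ a' → c x ≤ c (γ₂ • x) := by
    intro x hx
    by_cases hxb : γ₂ • x = b'
    · rw [← hxb, inv_smul_smul] at hrise'
      exact hrise'.le
    · exact (hstep' x hx hxb).ge
  have hcomm : γ₂ * γ₁ = γ₁ * γ₂ := by
    obtain ⟨k, rfl⟩ := hγ'
    exact ((Commute.refl γ₁).zpow_left k).eq
  have hmove : ∀ g : Γ, γ₂ * g = g * γ₂ → c (g • a') = c a → g • a' ≠ a' →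
      c (g • γ₂ • a') ≠ c (γ₁ • a) := by
    intro g hg hca hga h
    have hle := hle' _ hga
    rw [← mul_smul, hg, mul_smul, hca, h] at hle
    exact hdrop.not_ge hle
  have hγ1 : γ₁ ≠ 1 := by
    rintro rfl
    simp at hdrop
  have hlow_b : γ₁ • γ₂ • a' = b := by
    by_contra hcon
    have hup : c (γ₁ • a') = c a := by
      by_cases hb : γ₁ • a' = b
      · rw [hb, hhigh]
      · rw [hstep a' hne hb, hhigh']
    refine hmove γ₁ hcomm hup (fun h => hγ1 (hfree _ _ h)) ?_
    rw [hstep _ (fun h => hdrop.ne (by rw [← hlow', h])) hcon, hlow']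
  have hlow_a : γ₂ • a' = γ₁ • a := by
    rw [← inv_smul_eq_iff]
    by_contra hcon
    have hback : c (γ₁⁻¹ • a') = c a := by
      by_cases ha : γ₁⁻¹ • a' = a
      · rw [ha]
      · rw [← hstep _ ha (by rwa [smul_inv_smul]), smul_inv_smul, hhigh']
    refine hmove γ₁⁻¹ (Commute.inv_right hcomm).eq hback
      (fun h => hγ1 (inv_eq_one.1 (hfree _ _ h))) ?_
    rw [← hstep _ hcon, smul_inv_smul, hlow']
    rw [smul_inv_smul]
    rintro rfl
    exact hdrop.ne (hlow'.symm.trans hhigh)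
  set z := γ₁ • a with hz
  have hzO : z ∈ O := smul_mem_orbit_zpowers hγ haO
  have hzb : γ₁ • z = b := by rw [← hlow_a, hlow_b]
  have hmost : ∀ w ∈ O, w ≠ z → c w = c a := by
    intro w hw hwz
    by_contra hwa
    refine (forall_mem_orbit_zpowers_of_smul (γ := γ₁) (p := fun w => w ≠ z ∧ c w ≠ c a)
      (x := w) (y := z) (fun x hx => ?_) ⟨hwz, hwa⟩ ?_).1 rfl
    · have hxa : x ≠ a := by rintro rfl; exact hx.2 rfl
      refine ⟨fun h => hxa (smul_left_cancel γ₁ h), ?_⟩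
      rw [hstep x hxa fun h => hx.1 (smul_left_cancel γ₁ (h.trans hzb.symm))]
      exact hx.2
    · rwa [MulAction.orbit_eq_iff.2 hw]
  have hset : {x ∈ O | c x = c a} = O \ {z} := by
    ext x
    refine and_congr_right fun hx => ⟨?_, hmost x hx⟩
    rintro h rfl
    exact hdrop.ne h
  refine ⟨O, ⟨a, rfl⟩, ⟨c a, ⟨⟨a, haO, rfl⟩, ?_⟩, ?_⟩, ?_, hconst⟩
  · rintro _ ⟨x, hx, rfl⟩
    rcases htwo x hx with h | h <;> rw [h]
    exact hdrop.le
  · rw [hset, Set.ncard_sdiff_singleton_of_mem hzO]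
  · rintro O' hO' ⟨m, ⟨⟨x, hx, rfl⟩, -⟩, hcard⟩
    by_contra hcon
    have hall : {y ∈ O' | c y = c x} = O' :=
      Set.sep_eq_self_iff_mem_true.2 fun y hy => hconst O' hO' hcon y hy x hx
    have hpos := (Set.ncard_pos (Set.toFinite O')).2 ⟨x, hx⟩
    rw [hall] at hcard
    omega
end

section
/- Let Γ be a finite cyclic group acting freely on a finite set X, let Y be a totally ordered set, and let c : X → Y. Suppose α₁, β₁, α₂, β₂ : X → Y are four pairwise distinct children of c (αᵢ < c and βᵢ < c) with β₁ = γ₁·α₁ and β₂ = γ₂·α₂, where γ₁, γ₂ ∈ Γ satisfy γ₁ ∉ Aut(c) and γ₂ ∉ Aut(c). Let Γ' = ⟨γ₁, γ₂⟩. Then there exists a unique Γ'-orbit 𝒪 in X such that the number of x ∈ 𝒪 with c(x) = max c(𝒪) equals |𝒪| − 1; moreover c is constant on every Γ'-orbit P ≠ 𝒪, and c(x) = α₁(x) = β₁(x) = α₂(x) = β₂(x) for all x ∉ 𝒪. -/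
/-- A finite set of values in a linear order embeds strictly monotonically into `ℤ`. -/
theorem exists_int_strictMono_on_range {X Y : Type*} [Fintype X] [LinearOrder Y] (c : X → Y) :
    ∃ f : X → ℤ, ∀ x y, f x < f y ↔ c x < c y := by
  classical
  let φ : Y → ℤ := fun y => ((Finset.univ.image c).filter (· < y)).card
  have hlt : ∀ x y, c x < c y → φ (c x) < φ (c y) := by
    intro x y h
    simp only [φ, Nat.cast_lt]
    apply Finset.card_lt_card
    rw [Finset.ssubset_iff_of_subset]
    · exact ⟨c x, by simp [h], by simp⟩
    · intro z hz
      rw [Finset.mem_filter] at hz ⊢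
      exact ⟨hz.1, hz.2.trans h⟩
  refine ⟨fun x => φ (c x), fun x y => ⟨fun h => ?_, hlt x y⟩⟩
  by_contra hn
  rcases (not_lt.mp hn).lt_or_eq with h' | h'
  · exact (h.trans (hlt y x h')).false
  · simp only [h', lt_self_iff_false] at h

/-- Two proportional signed point configurations `[A] + [B] - [C] - [D]` without cancellation
agree, with equal factors. -/
theorem eq_of_proportional_point_masses {X : Type*} [DecidableEq X] {k l : ℤ} (hk : 0 < k)
    (hl : 0 < l) {A B C D E F G H : X} (hAC : A ≠ C) (hAD : A ≠ D) (hBC : B ≠ C) (hBD : B ≠ D)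
    (hEG : E ≠ G) (hEH : E ≠ H) (hFG : F ≠ G) (hFH : F ≠ H)
    (h : ∀ x, k * ((if x = A then 1 else 0) + (if x = B then 1 else 0) - (if x = C then 1 else 0)
      - (if x = D then 1 else 0)) = l * ((if x = E then 1 else 0) + (if x = F then 1 else 0)
      - (if x = G then 1 else 0) - (if x = H then 1 else 0))) :
    k = l ∧ ((A = E ∧ B = F) ∨ (A = F ∧ B = E)) ∧ ((C = G ∧ D = H) ∨ (C = H ∧ D = G)) := by
  have key : ∀ {A B C D E F G H : X}, A ≠ C → A ≠ D → B ≠ C → B ≠ D → E ≠ G → E ≠ H → F ≠ G →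
      F ≠ H →
      (∀ x, k * ((if x = A then 1 else 0) + (if x = B then 1 else 0) - (if x = C then 1 else 0)
      - (if x = D then 1 else 0)) = l * ((if x = E then 1 else 0) + (if x = F then 1 else 0)
      - (if x = G then 1 else 0) - (if x = H then 1 else 0))) →
      k = l ∧ ((A = E ∧ B = F) ∨ (A = F ∧ B = E)) := by
    intro A B C D E F G H hAC hAD hBC hBD hEG hEH hFG hFH h
    have hA := h A
    have hB := h B
    have hE := h E
    have hF := h F
    clear h
    grind
  obtain ⟨hkl, h₁⟩ := key hAC hAD hBC hBD hEG hEH hFG hFH h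
  refine ⟨hkl, h₁, (key hAC.symm hBC.symm hAD.symm hBD.symm hEG.symm hFG.symm hEH.symm hFH.symm
    fun x => ?_).2⟩
  linear_combination -h x

/-- If a translate by `g` of a child `α` of `c` is again a child `β` of `c` and `g` does not
stabilize `c`, then `c` drops along `g` at one point `a`, rises by the same amount at one other
point `p`, and is unchanged elsewhere. -/
theorem exists_drop_and_rise {Γ X Y : Type*} [Group Γ] [MulAction Γ X] [Fintype X]
    [DecidableEq X] [LinearOrder Y] {c α β : X → Y} {g : Γ} {f : X → ℤ}
    (hf : ∀ x y, f x < f y ↔ c x < c y)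
    (hα : (∃! x : X, α x ≠ c x) ∧ ∀ x : X, α x ≤ c x)
    (hβ : (∃! x : X, β x ≠ c x) ∧ ∀ x : X, β x ≤ c x)
    (hb : ∀ x : X, β x = α (g⁻¹ • x)) (hg : ¬ ∀ x : X, c (g⁻¹ • x) = c x) :
    ∃ (a p : X) (k : ℤ), 0 < k ∧ a ≠ p ∧ α a = c (g • a) ∧ β (g • p) = c p ∧
      (∀ x, x ≠ a → α x = c x) ∧ (∀ x, x ≠ g • p → β x = c x) ∧
      ∀ x, f (g • x) - f x = k * ((if x = p then 1 else 0) - (if x = a then 1 else 0)) := by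
  have hfc : ∀ {x y}, f x = f y ↔ c x = c y := by
    intro x y
    have h₁ := hf x y
    have h₂ := hf y x
    constructor <;> intro h <;> apply le_antisymm <;> rw [← not_lt] <;> simp_all
  obtain ⟨⟨a, ha, ha'⟩, hα⟩ := hα
  obtain ⟨⟨b, hb₀, hb'⟩, hβ⟩ := hβ
  have hα' : ∀ x, x ≠ a → α x = c x := fun x hx => by
    by_contra h
    exact hx (ha' x h)
  have hβ' : ∀ x, x ≠ b → β x = c x := fun x hx => by
    by_contra h
    exact hx (hb' x h)
  obtain ⟨p, rfl⟩ : ∃ p, b = g • p := ⟨g⁻¹ • b, by simp⟩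
  have hb : ∀ x, β (g • x) = α x := fun x => by simp [hb]
  have hstep : ∀ x, x ≠ a → x ≠ p → f (g • x) - f x = 0 := by
    intro x hxa hxp
    rw [sub_eq_zero, hfc, ← hα' x hxa, ← hb, hβ' _ (by simpa using hxp)]
  have hsum : ∑ x, (f (g • x) - f x) = 0 := by
    rw [Finset.sum_sub_distrib, sub_eq_zero]
    exact Equiv.sum_comp (MulAction.toPerm g) f
  have hap : a ≠ p := by
    rintro rfl
    rw [Fintype.sum_eq_single a fun x hx => hstep x hx hx] at hsum
    refine hg fun x => ?_
    have : f (g • (g⁻¹ • x)) - f (g⁻¹ • x) = 0 := by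
      by_cases h : g⁻¹ • x = a
      · rwa [h]
      · exact hstep _ h h
    rw [smul_inv_smul, sub_eq_zero, hfc] at this
    exact this.symm
  have hαa : α a = c (g • a) := by rw [← hb, hβ' _ (by simpa using hap)]
  have hβp : β (g • p) = c p := by rw [hb, hα' _ hap.symm]
  rw [Fintype.sum_eq_add a p hap fun x hx => hstep x hx.1 hx.2] at hsum
  have hk : f (g • a) < f a := by
    rw [hf, ← hαa]
    exact lt_of_le_of_ne (hα a) ha
  refine ⟨a, p, f a - f (g • a), by linarith, hap, hαa, hβp, hα', hβ', fun x => ?_⟩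
  by_cases hxa : x = a
  · subst hxa
    simp [hap]
  by_cases hxp : x = p
  · subst hxp
    simp [hxa]
    linarith
  · simp [hxa, hxp, hstep x hxa hxp]

/-- If raising the value of `c` at `q` to `M` gives a function invariant under `H`, and `h • q` for
some `h ∈ H` differs from `q`, then the orbit of `q` is the unique one on which `c` takes its
maximum at all points but one. -/
theorem orbit_unique_of_update_invariant {Γ X Y : Type*} [Group Γ] [MulAction Γ X] [Finite X]
    [DecidableEq X] [LinearOrder Y] {H : Subgroup Γ} {c : X → Y} {q : X} {M : Y} (hM : c q < M)
    (hinv : ∀ h ∈ H, ∀ x, Function.update c q M (h • x) = Function.update c q M x)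
    (hmove : ∃ h ∈ H, h • q ≠ q) :
    (∃ ymax : Y, IsGreatest (c '' MulAction.orbit H q) ymax ∧
      {x ∈ MulAction.orbit H q | c x = ymax}.ncard = (MulAction.orbit H q).ncard - 1) ∧
    (∀ O' : Set X, (∃ x : X, O' = MulAction.orbit H x) →
      (∃ ymax : Y, IsGreatest (c '' O') ymax ∧
        {x ∈ O' | c x = ymax}.ncard = O'.ncard - 1) → O' = MulAction.orbit H q) ∧
    (∀ P : Set X, (∃ x : X, P = MulAction.orbit H x) →
      P ≠ MulAction.orbit H q → ∀ x ∈ P, ∀ y ∈ P, c x = c y) := by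
  have hoff : ∀ x, x ≠ q → Function.update c q M x = c x := fun x hx => by simp [hx]
  have horb : ∀ x, ∀ y ∈ MulAction.orbit H x,
      Function.update c q M y = Function.update c q M x := by
    rintro x _ ⟨⟨h, hh⟩, rfl⟩
    exact hinv h hh x
  have hq : ∀ y ∈ MulAction.orbit H q, y ≠ q → c y = M := by
    intro y hy hyq
    rw [← hoff y hyq, horb q y hy, Function.update_self]
  have hconst : ∀ P : Set X, (∃ x : X, P = MulAction.orbit H x) →
      P ≠ MulAction.orbit H q → ∀ x ∈ P, ∀ y ∈ P, c x = c y := by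
    rintro _ ⟨z, rfl⟩ hne x hx y hy
    have hqz : q ∉ MulAction.orbit H z := fun h => hne (MulAction.orbit_eq_iff.mpr h).symm
    rw [← hoff x (fun h => hqz (h ▸ hx)), ← hoff y (fun h => hqz (h ▸ hy)), horb z x hx,
      horb z y hy]
  refine ⟨⟨M, ⟨?_, ?_⟩, ?_⟩, ?_, hconst⟩
  · obtain ⟨h, hh, hne⟩ := hmove
    have hmem : h • q ∈ MulAction.orbit H q := ⟨⟨h, hh⟩, rfl⟩
    exact ⟨h • q, hmem, hq _ hmem hne⟩
  · rintro _ ⟨y, hy, rfl⟩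
    by_cases hyq : y = q
    · exact hyq ▸ hM.le
    · exact (hq y hy hyq).le
  · rw [← Set.ncard_sdiff_singleton_of_mem (MulAction.mem_orbit_self (M := H) q)]
    congr 1
    ext y
    simp only [Set.mem_ofPred_eq, Set.mem_sdiff, Set.mem_singleton_iff]
    refine and_congr_right fun hy => ⟨?_, hq y hy⟩
    rintro h rfl
    exact hM.ne h
  · rintro O' hO' ⟨ymax, ⟨⟨z, hz, hzm⟩, -⟩, hcard⟩
    by_contra hne
    have hall : {x ∈ O' | c x = ymax} = O' := by
      ext x
      simp only [Set.mem_ofPred_eq, and_iff_left_iff_imp]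
      intro hx
      rw [← hzm, hconst O' hO' hne x hx z hz]
    rw [hall] at hcard
    have hpos : 0 < O'.ncard := (Set.ncard_pos (Set.toFinite O')).mpr ⟨z, hz⟩
    omega


/-- If `α₁, β₁, α₂, β₂` are four pairwise distinct children of `c` with
`β₁ = γ₁·α₁`, `β₂ = γ₂·α₂` and `γ₁, γ₂ ∉ Aut(c)`, and `Γ' = ⟨γ₁, γ₂⟩`, then there
is a unique `Γ'`-orbit `𝒪` with `|c⁻¹(max c(𝒪)) ∩ 𝒪| = |𝒪| - 1`, `c` is constant
on every other `Γ'`-orbit, and `c = αᵢ = βᵢ` outside `𝒪`. -/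
theorem stmt_17 {Γ X Y : Type*} [Group Γ] [Fintype Γ] [IsCyclic Γ]
    [MulAction Γ X] [Fintype X] [LinearOrder Y]
    (hfree : ∀ (g : Γ) (x : X), g • x = x → g = 1)
    (c α₁ β₁ α₂ β₂ : X → Y) (γ₁ γ₂ : Γ)
    (hdist : α₁ ≠ β₁ ∧ α₁ ≠ α₂ ∧ α₁ ≠ β₂ ∧ β₁ ≠ α₂ ∧ β₁ ≠ β₂ ∧ α₂ ≠ β₂)
    (hc1 : (∃! x : X, α₁ x ≠ c x) ∧ ∀ x : X, α₁ x ≤ c x)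
    (hc2 : (∃! x : X, β₁ x ≠ c x) ∧ ∀ x : X, β₁ x ≤ c x)
    (hc3 : (∃! x : X, α₂ x ≠ c x) ∧ ∀ x : X, α₂ x ≤ c x)
    (hc4 : (∃! x : X, β₂ x ≠ c x) ∧ ∀ x : X, β₂ x ≤ c x)
    (hb1 : ∀ x : X, β₁ x = α₁ (γ₁⁻¹ • x)) (hb2 : ∀ x : X, β₂ x = α₂ (γ₂⁻¹ • x))
    (hg1 : ¬ ∀ x : X, c (γ₁⁻¹ • x) = c x) (hg2 : ¬ ∀ x : X, c (γ₂⁻¹ • x) = c x) :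
    ∃ O : Set X,
      (∃ x : X, O = MulAction.orbit (Subgroup.closure {γ₁, γ₂} : Subgroup Γ) x) ∧
      (∃ ymax : Y, IsGreatest (c '' O) ymax ∧
        {x ∈ O | c x = ymax}.ncard = O.ncard - 1) ∧
      (∀ O' : Set X,
        (∃ x : X, O' = MulAction.orbit (Subgroup.closure {γ₁, γ₂} : Subgroup Γ) x) →
        (∃ ymax : Y, IsGreatest (c '' O') ymax ∧
          {x ∈ O' | c x = ymax}.ncard = O'.ncard - 1) → O' = O) ∧
      (∀ P : Set X,
        (∃ x : X, P = MulAction.orbit (Subgroup.closure {γ₁, γ₂} : Subgroup Γ) x) →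
        P ≠ O → ∀ x ∈ P, ∀ y ∈ P, c x = c y) ∧
      (∀ x : X, x ∉ O → c x = α₁ x ∧ c x = β₁ x ∧ c x = α₂ x ∧ c x = β₂ x) := by
  classical
  obtain ⟨f, hf⟩ := exists_int_strictMono_on_range c
  have hfc : ∀ {x y}, f x = f y → c x = c y := fun {x y} h =>
    le_antisymm (not_lt.mp fun h' => ((hf y x).mpr h').ne h.symm)
      (not_lt.mp fun h' => ((hf x y).mpr h').ne h)
  obtain ⟨a₁, p₁, k₁, hk₁, hap₁, hαa₁, hβp₁, hα₁, hβ₁, hd₁⟩ := exists_drop_and_rise hf hc1 hc2 hb1 hg1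
  obtain ⟨a₂, p₂, k₂, hk₂, hap₂, hαa₂, hβp₂, hα₂, hβ₂, hd₂⟩ := exists_drop_and_rise hf hc3 hc4 hb2 hg2
  have hne₁ : ∀ x : X, γ₁⁻¹ • x ≠ x := fun x h => hg1 fun y => by simp [hfree _ _ h]
  have hne₂ : ∀ x : X, γ₂⁻¹ • x ≠ x := fun x h => hg2 fun y => by simp [hfree _ _ h]
  have hcomm : γ₁ * γ₂ = γ₂ * γ₁ := by
    let _ := IsCyclic.commGroup (α := Γ)
    exact mul_comm γ₁ γ₂
  obtain ⟨hk, hpos, hneg⟩ := eq_of_proportional_point_masses hk₁ hk₂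
    (A := γ₂⁻¹ • p₁) (B := a₁) (C := p₁) (D := γ₂⁻¹ • a₁)
    (E := γ₁⁻¹ • p₂) (F := a₂) (G := p₂) (H := γ₁⁻¹ • a₂)
    (hne₂ p₁) (by simpa using hap₁.symm) hap₁ (hne₂ a₁).symm
    (hne₁ p₂) (by simpa using hap₂.symm) hap₂ (hne₁ a₂).symm (by
      intro x
      have h₁ := hd₁ (γ₂ • x)
      have h₂ := hd₂ (γ₁ • x)
      have h₃ : γ₁ • γ₂ • x = γ₂ • γ₁ • x := by rw [smul_smul, smul_smul, hcomm]
      rw [h₃] at h₁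
      simp only [← eq_inv_smul_iff] at h₁ h₂
      linear_combination h₂ - h₁ + hd₁ x - hd₂ x)
  subst hk
  have hda₁ := hd₁ a₁
  have hda₂ := hd₂ a₂
  have hdp₁ := hd₁ p₁
  have hdp₂ := hd₂ p₂
  simp only [hap₁, hap₂, hap₁.symm, hap₂.symm, if_true, if_false] at hda₁ hda₂ hdp₁ hdp₂
  have hαα : a₁ ≠ a₂ := by
    rintro rfl
    refine hdist.2.1 (funext fun x => ?_)
    by_cases hx : x = a₁
    · rw [hx, hαa₁, hαa₂]
      exact hfc (by linarith)
    · rw [hα₁ x hx, hα₂ x hx]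
  have hβα : γ₁ • p₁ ≠ a₂ := by
    intro h
    refine hdist.2.2.2.1 (funext fun x => ?_)
    by_cases hx : x = a₂
    · rw [hx, hαa₂, ← h, hβp₁, h]
      rw [h] at hdp₁
      exact hfc (by linarith)
    · rw [hβ₁ x (h ▸ hx), hα₂ x hx]
  obtain ⟨h₁, h₂⟩ : γ₂⁻¹ • p₁ = a₂ ∧ a₁ = γ₁⁻¹ • p₂ := by tauto
  obtain ⟨rfl, -⟩ : p₁ = p₂ ∧ γ₂⁻¹ • a₁ = γ₁⁻¹ • a₂ := by
    refine hneg.resolve_right fun h => hβα ?_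
    rw [h.1, smul_inv_smul]
  subst h₁ h₂
  rw [smul_inv_smul] at hda₁ hda₂
  have hM : c p₁ < c (γ₁ • p₁) := (hf _ _).mp (by linarith)
  have hc₁ : c (γ₁⁻¹ • p₁) = c (γ₁ • p₁) := hfc (by linarith)
  have hc₂ : c (γ₂⁻¹ • p₁) = c (γ₁ • p₁) := hfc (by linarith)
  have hc₂' : c (γ₂ • p₁) = c (γ₁ • p₁) := hfc (by linarith)
  have hγ : ∀ g : Γ, (∀ x : X, g⁻¹ • x ≠ x) → c (g • p₁) = c (γ₁ • p₁) →
      c (g⁻¹ • p₁) = c (γ₁ • p₁) → (∀ x, f (g • x) - f x =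
        k₁ * ((if x = p₁ then 1 else 0) - (if x = g⁻¹ • p₁ then 1 else 0))) →
      ∀ x, Function.update c p₁ (c (γ₁ • p₁)) (g • x) =
        Function.update c p₁ (c (γ₁ • p₁)) x := by
    intro g hne hc hc' hd x
    by_cases hx : x = p₁
    · subst hx
      have : g • x ≠ x := fun h => hne x (inv_smul_eq_iff.mpr h.symm)
      simp [this, hc]
    by_cases hgx : x = g⁻¹ • p₁
    · subst hgx
      simp [hne, hc']
    · have hgx' : g • x ≠ p₁ := fun h => hgx (eq_inv_smul_iff.mpr h)
      have := hd x
      simp only [hx, hgx, if_false, sub_zero, mul_zero, sub_eq_zero] at this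
      simp [hx, hgx', hfc this]
  have hmem₁ : γ₁ ∈ Subgroup.closure {γ₁, γ₂} := Subgroup.subset_closure (by simp)
  have hmem₂ : γ₂ ∈ Subgroup.closure {γ₁, γ₂} := Subgroup.subset_closure (by simp)
  have hinv : ∀ h ∈ Subgroup.closure {γ₁, γ₂}, ∀ x,
      Function.update c p₁ (c (γ₁ • p₁)) (h • x) = Function.update c p₁ (c (γ₁ • p₁)) x := by
    intro h hh
    induction hh using Subgroup.closure_induction with
    | mem g hg =>
      rcases hg with rfl | rfl
      · exact hγ _ hne₁ rfl hc₁ hd₁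
      · exact hγ _ hne₂ hc₂' hc₂ hd₂
    | one => simp
    | mul g h _ _ ihg ihh => exact fun x => by rw [mul_smul, ihg, ihh]
    | inv g _ ih => exact fun x => by rw [← ih (g⁻¹ • x), smul_inv_smul]
  obtain ⟨hmax, huniq, hconst⟩ := orbit_unique_of_update_invariant hM hinv
    ⟨γ₁, hmem₁, fun h => hM.ne (by rw [h])⟩
  refine ⟨_, ⟨p₁, rfl⟩, hmax, huniq, hconst, fun x hx => ?_⟩
  have hxne : ∀ g ∈ Subgroup.closure {γ₁, γ₂}, x ≠ g • p₁ := by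
    rintro g hg rfl
    exact hx ⟨⟨g, hg⟩, rfl⟩
  exact ⟨(hα₁ x (hxne _ (inv_mem hmem₁))).symm, (hβ₁ x (hxne _ hmem₁)).symm,
    (hα₂ x (hxne _ (inv_mem hmem₂))).symm, (hβ₂ x (hxne _ hmem₂)).symm⟩
end

section
/- Let Γ be a finite cyclic group acting freely on a finite set X, let Y be a totally ordered set, and let c : X → Y. Suppose α₁, β₁, α₂, β₂ : X → Y are four pairwise distinct children of c (αᵢ < c and βᵢ < c) with β₁ = γ₁·α₁ and β₂ = γ₂·α₂, where γ₁, γ₂ ∈ Γ satisfy γ₁ ∉ Aut(c) and γ₂ ∉ Aut(c), and let Γ' = ⟨γ₁, γ₂⟩. Then the unique Γ'-orbit 𝒪 on which c is not constant (equivalently, the unique Γ'-orbit with |{x ∈ 𝒪 : c(x) = max c(𝒪)}| = |𝒪| − 1) satisfies |𝒪| ≥ 5. -/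
/-- `f` is obtained from `c` by replacing the value at the unique point `a` where
`c (g • a) < c a` by `c (g • a)`. -/
def IsDescentOf {Γ X Y : Type*} [SMul Γ X] [LT Y] (c : X → Y) (g : Γ) (f : X → Y) : Prop :=
  ∃ a, c (g • a) < c a ∧ (∀ x, c (g • x) < c x → x = a) ∧ f a = c (g • a) ∧
    ∀ x, x ≠ a → f x = c x

theorem IsDescentOf.unique {Γ X Y : Type*} [SMul Γ X] [LT Y] {c : X → Y} {g : Γ} {f f' : X → Y}
    (h : IsDescentOf c g f) (h' : IsDescentOf c g f') : f = f' := by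
  obtain ⟨a, ha, -, hfa, hf⟩ := h
  obtain ⟨a', -, hu', hfa', hf'⟩ := h'
  obtain rfl := hu' a ha
  funext x
  by_cases hx : x = a
  · rw [hx, hfa, hfa']
  · rw [hf x hx, hf' x hx]

/-- A function on a `Γ`-set that is invariant under `g` away from one point is `g`-invariant. -/
theorem apply_inv_smul_eq_of_forall_ne {Γ X Y : Type*} [Group Γ] [Finite Γ] [MulAction Γ X]
    {c : X → Y} {g : Γ} {b : X} (h : ∀ x, x ≠ b → c (g⁻¹ • x) = c x) (x : X) :
    c (g⁻¹ • x) = c x := by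
  by_cases hx : x = b
  · have hpow : ∀ k : ℕ, c (g ^ k • b) = c b := by
      intro k
      induction k with
      | zero => simp
      | succ k ih =>
        by_cases hk : g ^ (k + 1) • b = b
        · rw [hk]
        · rw [← h _ hk, smul_smul, pow_succ', inv_mul_cancel_left, ih]
    obtain ⟨k, hk⟩ := (isOfFinOrder_of_finite g).mem_powers_iff_mem_zpowers.mpr
      (inv_mem (Subgroup.mem_zpowers g))
    rw [hx, ← hk]
    exact hpow k
  · exact h x hx

/-- If two children of `c` are related by `g`, which does not stabilize `c`, then the first one is
the descent of `c` along `g`. -/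
theorem isDescentOf_of_children {Γ X Y : Type*} [Group Γ] [Finite Γ] [MulAction Γ X]
    [LinearOrder Y] {c α β : X → Y} {g : Γ}
    (hα : (∃! x : X, α x ≠ c x) ∧ ∀ x : X, α x ≤ c x)
    (hβ : (∃! x : X, β x ≠ c x) ∧ ∀ x : X, β x ≤ c x)
    (hαβ : ∀ x : X, β x = α (g⁻¹ • x)) (hg : ¬ ∀ x : X, c (g⁻¹ • x) = c x) :
    IsDescentOf c g α := by
  obtain ⟨⟨a, ha, hua⟩, hαc⟩ := hα
  obtain ⟨⟨b, hb, hub⟩, hβc⟩ := hβ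
  have hα_eq : ∀ x, x ≠ a → α x = c x := fun x hx => by_contra fun h => hx (hua x h)
  have hβ_eq : ∀ x, x ≠ b → β x = c x := fun x hx => by_contra fun h => hx (hub x h)
  have hβ_smul : ∀ x, β (g • x) = α x := fun x => by rw [hαβ, inv_smul_smul]
  have hne : g • a ≠ b := by
    intro hab
    refine hg (apply_inv_smul_eq_of_forall_ne (b := b) fun x hx => ?_)
    have hxa : g⁻¹ • x ≠ a := fun h => hx (by rw [← hab, ← h, smul_inv_smul])
    rw [← hα_eq _ hxa, ← hαβ, hβ_eq x hx]
  have hval : α a = c (g • a) := by rw [← hβ_smul, hβ_eq _ hne]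
  refine ⟨a, hval ▸ lt_of_le_of_ne (hαc a) ha, fun x hx => ?_, hval, hα_eq⟩
  by_contra hxa
  have hle := hβc (g • x)
  rw [hβ_smul, hα_eq x hxa] at hle
  exact absurd hx hle.not_gt

/-- Under the assumptions of the twins proposition, the unique `⟨γ₁, γ₂⟩`-orbit on
which `c` is not constant has at least 5 elements. -/
theorem stmt_18 {Γ X Y : Type*} [Group Γ] [Fintype Γ] [IsCyclic Γ]
    [MulAction Γ X] [Fintype X] [LinearOrder Y]
    (hfree : ∀ (g : Γ) (x : X), g • x = x → g = 1)
    (c α₁ β₁ α₂ β₂ : X → Y) (γ₁ γ₂ : Γ)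
    (hdist : α₁ ≠ β₁ ∧ α₁ ≠ α₂ ∧ α₁ ≠ β₂ ∧ β₁ ≠ α₂ ∧ β₁ ≠ β₂ ∧ α₂ ≠ β₂)
    (hc1 : (∃! x : X, α₁ x ≠ c x) ∧ ∀ x : X, α₁ x ≤ c x)
    (hc2 : (∃! x : X, β₁ x ≠ c x) ∧ ∀ x : X, β₁ x ≤ c x)
    (hc3 : (∃! x : X, α₂ x ≠ c x) ∧ ∀ x : X, α₂ x ≤ c x)
    (hc4 : (∃! x : X, β₂ x ≠ c x) ∧ ∀ x : X, β₂ x ≤ c x)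
    (hb1 : ∀ x : X, β₁ x = α₁ (γ₁⁻¹ • x)) (hb2 : ∀ x : X, β₂ x = α₂ (γ₂⁻¹ • x))
    (hg1 : ¬ ∀ x : X, c (γ₁⁻¹ • x) = c x) (hg2 : ¬ ∀ x : X, c (γ₂⁻¹ • x) = c x) :
    ∀ x₀ : X,
      (∃ y ∈ MulAction.orbit (Subgroup.closure {γ₁, γ₂} : Subgroup Γ) x₀,
        ∃ z ∈ MulAction.orbit (Subgroup.closure {γ₁, γ₂} : Subgroup Γ) x₀,
          c y ≠ c z) →
      5 ≤ (MulAction.orbit (Subgroup.closure {γ₁, γ₂} : Subgroup Γ) x₀).ncard := by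
  classical
  intro x₀ _
  obtain ⟨h₁, h₂, h₃, h₄, h₅, h₆⟩ := hdist
  have inv_relation : ∀ {α β : X → Y} {g : Γ}, (∀ x, β x = α (g⁻¹ • x)) →
      ∀ x, α x = β ((g⁻¹)⁻¹ • x) := fun h x => by rw [h, inv_inv, inv_smul_smul]
  have inv_not_stab : ∀ {g : Γ}, (¬ ∀ x : X, c (g⁻¹ • x) = c x) →
      ¬ ∀ x : X, c ((g⁻¹)⁻¹ • x) = c x := fun {g} hg h =>
    hg fun x => by rw [← h (g⁻¹ • x), inv_inv, smul_inv_smul]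
  have hα₁ := isDescentOf_of_children hc1 hc2 hb1 hg1
  have hβ₁ := isDescentOf_of_children hc2 hc1 (inv_relation hb1) (inv_not_stab hg1)
  have hα₂ := isDescentOf_of_children hc3 hc4 hb2 hg2
  have hβ₂ := isDescentOf_of_children hc4 hc3 (inv_relation hb2) (inv_not_stab hg2)
  have ne_of_ne : ∀ {g g' : Γ} {f f' : X → Y}, IsDescentOf c g f → IsDescentOf c g' f' →
      f ≠ f' → g ≠ g' := fun hf hf' hne hgg => hne (hf.unique (hgg ▸ hf'))
  have n₁ := ne_of_ne hα₁ hβ₁ h₁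
  have n₂ := ne_of_ne hα₁ hα₂ h₂
  have n₃ := ne_of_ne hα₁ hβ₂ h₃
  have n₄ := ne_of_ne hβ₁ hα₂ h₄
  have n₅ := ne_of_ne hβ₁ hβ₂ h₅
  have n₆ := ne_of_ne hα₂ hβ₂ h₆
  have one₁ : γ₁ ≠ 1 := fun h => n₁ (by simp [h])
  have one₂ : γ₂ ≠ 1 := fun h => n₆ (by simp [h])
  let S : Finset Γ := {1, γ₁, γ₁⁻¹, γ₂, γ₂⁻¹}
  have hS : S.card = 5 := by
    have i₁ : (1 : Γ) ≠ γ₁⁻¹ := fun h => one₁ (inv_eq_one.mp h.symm)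
    have i₂ : (1 : Γ) ≠ γ₂⁻¹ := fun h => one₂ (inv_eq_one.mp h.symm)
    simp only [S]
    rw [Finset.card_insert_of_notMem, Finset.card_insert_of_notMem,
      Finset.card_insert_of_notMem, Finset.card_pair n₆] <;>
      simp only [Finset.mem_insert, Finset.mem_singleton, not_or]
    exacts [⟨n₄, n₅⟩, ⟨n₁, n₂, n₃⟩, ⟨one₁.symm, i₁, one₂.symm, i₂⟩]
  have hinj : Function.Injective fun g : Γ => g • x₀ := by
    intro g g' h
    have h' : (g'⁻¹ * g) • x₀ = x₀ := by
      rw [mul_smul, inv_smul_eq_iff]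
      exact h
    exact (inv_mul_eq_one.mp (hfree _ _ h')).symm
  have hmem₁ : γ₁ ∈ Subgroup.closure {γ₁, γ₂} := Subgroup.subset_closure (by simp)
  have hmem₂ : γ₂ ∈ Subgroup.closure {γ₁, γ₂} := Subgroup.subset_closure (by simp)
  have hSle : ∀ g ∈ S, g ∈ Subgroup.closure {γ₁, γ₂} := by
    intro g hg
    simp only [S, Finset.mem_insert, Finset.mem_singleton] at hg
    rcases hg with rfl | rfl | rfl | rfl | rfl
    exacts [one_mem _, hmem₁, inv_mem hmem₁, hmem₂, inv_mem hmem₂]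
  rw [← hS, ← Finset.card_image_of_injective S hinj, ← Set.ncard_coe_finset]
  refine Set.ncard_le_ncard (fun y hy => ?_) (Set.toFinite _)
  obtain ⟨g, hg, rfl⟩ := Finset.mem_image.mp (Finset.mem_coe.mp hy)
  exact ⟨⟨g, hSle g hg⟩, rfl⟩
end
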